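/- arXiv:1107.1014 — 2 statements merged into one kernel-verified Lean document; each statement's English description precedes it below -/
import Mathlib

section
/- Let c satisfy (B0)–(B1), let u = u^{c*c} be c-convex (so ∂ᶜu(cl U) = cl V), and let λ > 0. If |∂ᶜu| ≥ λ on a set X ⊂ cl U, and V is strongly c*-convex with respect to X (i.e. V_x̄ := −D_x c(x̄, V) is strongly convex for every x̄ ∈ X), then interior points of X cannot be mapped by ∂ᶜu to boundary points of V: (X × ∂V) ∩ ∂ᶜu ⊂ ∂X × ∂V. -/
open Set MeasureTheory Metric Bornology
open scoped ENNReal NNReal Pointwise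

noncomputable section

abbrev Euc (n : ℕ) := EuclideanSpace ℝ (Fin n)

/-- Partial gradient of the cost in the first variable: `D_x c(x,y)`. -/
noncomputable def gradX (n : ℕ) (c : Euc n → Euc n → ℝ) (x y : Euc n) : Euc n :=
  gradient (fun x' => c x' y) x

/-- Partial gradient of the cost in the second variable: `D_y c(x,y)`. -/
noncomputable def gradY (n : ℕ) (c : Euc n → Euc n → ℝ) (x y : Euc n) : Euc n :=
  gradient (fun y' => c x y') y

/-- Mixed second derivative `D²_{xy} c` as a continuous linear map. -/
noncomputable def DxyC (n : ℕ) (c : Euc n → Euc n → ℝ) (x y : Euc n) : Euc n →L[ℝ] Euc n :=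
  fderiv ℝ (fun x' => gradY n c x' y) x

/-- Second derivative `D²_{xx} c`. -/
noncomputable def DxxC (n : ℕ) (c : Euc n → Euc n → ℝ) (x y : Euc n) : Euc n →L[ℝ] Euc n :=
  fderiv ℝ (fun x' => gradX n c x' y) x

/-- Third derivative `D²_{xx} D_y c`. -/
noncomputable def DxxyC (n : ℕ) (c : Euc n → Euc n → ℝ) (x y : Euc n) :
    Euc n →L[ℝ] Euc n →L[ℝ] Euc n :=
  fderiv ℝ (fun x' => DxyC n c x' y) x

/-- `β⁺_c = ‖D²_{xy} c‖_{L∞(U×V)}`. -/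
noncomputable def betaPlus (n : ℕ) (c : Euc n → Euc n → ℝ) (U V : Set (Euc n)) : ℝ :=
  sSup ((fun p : Euc n × Euc n => ‖DxyC n c p.1 p.2‖) '' (U ×ˢ V))

/-- `β⁻_c = ‖(D²_{xy} c)⁻¹‖_{L∞(U×V)}`. -/
noncomputable def betaMinus (n : ℕ) (c : Euc n → Euc n → ℝ) (U V : Set (Euc n)) : ℝ :=
  sSup ((fun p : Euc n × Euc n => ‖(DxyC n c p.1 p.2).inverse‖) '' (U ×ˢ V))

/-- `γ⁺_c = ‖det D²_{xy} c‖_{L∞(U×V)}`. -/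
noncomputable def gammaPlus (n : ℕ) (c : Euc n → Euc n → ℝ) (U V : Set (Euc n)) : ℝ :=
  sSup ((fun p : Euc n × Euc n =>
    |LinearMap.det ((DxyC n c p.1 p.2 : Euc n →L[ℝ] Euc n) : Euc n →ₗ[ℝ] Euc n)|) '' (U ×ˢ V))

/-- `γ⁻_c = ‖(det D²_{xy} c)⁻¹‖_{L∞(U×V)}`. -/
noncomputable def gammaMinus (n : ℕ) (c : Euc n → Euc n → ℝ) (U V : Set (Euc n)) : ℝ :=
  sSup ((fun p : Euc n × Euc n =>
    |LinearMap.det ((DxyC n c p.1 p.2 : Euc n →L[ℝ] Euc n) : Euc n →ₗ[ℝ] Euc n)|⁻¹) '' (U ×ˢ V))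

noncomputable def supDxx (n : ℕ) (c : Euc n → Euc n → ℝ) (U V : Set (Euc n)) : ℝ :=
  sSup ((fun p : Euc n × Euc n => ‖DxxC n c p.1 p.2‖) '' (U ×ˢ V))

noncomputable def supDx (n : ℕ) (c : Euc n → Euc n → ℝ) (U V : Set (Euc n)) : ℝ :=
  sSup ((fun p : Euc n × Euc n => ‖gradX n c p.1 p.2‖) '' (U ×ˢ V))

noncomputable def supDxxy (n : ℕ) (c : Euc n → Euc n → ℝ) (U V : Set (Euc n)) : ℝ :=
  sSup ((fun p : Euc n × Euc n => ‖DxxyC n c p.1 p.2‖) '' (U ×ˢ V))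

/-- The constant `M_c` from Theorem 4.3. -/
noncomputable def Mconst (n : ℕ) (c : Euc n → Euc n → ℝ) (U V : Set (Euc n)) : ℝ :=
  (betaMinus n c U V) ^ 2 * supDxx n c U V +
    (betaMinus n c U V) ^ 3 * supDx n c U V * supDxxy n c U V

/-- The constant `ε_c` of Lemma 6.1: `1/ε_c = 2 (β⁺)⁴ (β⁻)⁶ ‖D³_{xxy} c‖_∞`. -/
noncomputable def epsC (n : ℕ) (c : Euc n → Euc n → ℝ) (U V : Set (Euc n)) : ℝ :=
  (2 * (betaPlus n c U V) ^ 4 * (betaMinus n c U V) ^ 6 * supDxxy n c U V)⁻¹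

/-- Condition (B0). -/
def B0cond (n : ℕ) (c : Euc n → Euc n → ℝ) (U V : Set (Euc n)) : Prop :=
  IsOpen U ∧ IsBounded U ∧ IsOpen V ∧ IsBounded V ∧
    ContDiffOn ℝ 4 (Function.uncurry c) (closure U ×ˢ closure V)

/-- `f` is a (C¹-) diffeomorphism from `S` onto its range. -/
def DiffeoOnto (n : ℕ) (f : Euc n → Euc n) (S : Set (Euc n)) : Prop :=
  Set.InjOn f S ∧ ContDiffOn ℝ 1 f S ∧ ContDiffOn ℝ 1 (Function.invFunOn f S) (f '' S)

/-- Condition (B1) (bi-twist). -/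
def B1cond (n : ℕ) (c : Euc n → Euc n → ℝ) (U V : Set (Euc n)) : Prop :=
  (∀ y ∈ closure V, DiffeoOnto n (fun x => -gradY n c x y) (closure U)) ∧
  (∀ x ∈ closure U, DiffeoOnto n (fun y => -gradX n c x y) (closure V))

/-- `U_ȳ := -D_y c(U, ȳ)`. -/
def Uyset (n : ℕ) (c : Euc n → Euc n → ℝ) (U : Set (Euc n)) (ybar : Euc n) : Set (Euc n) :=
  (fun x => -gradY n c x ybar) '' U

/-- `V_x̄ := -D_x c(x̄, V)`. -/
def Vxset (n : ℕ) (c : Euc n → Euc n → ℝ) (V : Set (Euc n)) (xbar : Euc n) : Set (Euc n) :=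
  (fun y => -gradX n c xbar y) '' V

/-- Condition (B2) (bi-convexity). -/
def B2cond (n : ℕ) (c : Euc n → Euc n → ℝ) (U V : Set (Euc n)) : Prop :=
  (∀ y ∈ closure V, Convex ℝ (Uyset n c U y)) ∧ (∀ x ∈ closure U, Convex ℝ (Vxset n c V x))

/-- A strongly convex set: each boundary point is touched from outside by a sphere of
radius `R` enclosing the set. -/
def StronglyConvexSet (n : ℕ) (Q : Set (Euc n)) : Prop :=
  Convex ℝ Q ∧ ∃ R : ℝ, 0 < R ∧ ∀ x ∈ frontier Q, ∃ z : Euc n, dist x z = R ∧ Q ⊆ closedBall z R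

/-- Condition (B2s). -/
def B2scond (n : ℕ) (c : Euc n → Euc n → ℝ) (U V : Set (Euc n)) : Prop :=
  (∀ y ∈ closure V, StronglyConvexSet n (Uyset n c U y)) ∧
  (∀ x ∈ closure U, StronglyConvexSet n (Vxset n c V x))

/-- An affinely parameterized line segment on `[-1,1]`. -/
def IsAffineSeg (n : ℕ) (F : ℝ → Euc n × Euc n) : Prop :=
  ∃ a b : Euc n × Euc n, ∀ t ∈ Icc (-1 : ℝ) 1, F t = a + t • b

/-- `∂²/∂s∂t c(x(s), y(t))` at `(0,0)`. -/
noncomputable def crossDiff2 (n : ℕ) (c : Euc n → Euc n → ℝ) (x y : ℝ → Euc n) : ℝ :=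
  deriv (fun s => deriv (fun t => c (x s) (y t)) 0) 0

/-- `∂⁴/∂s²∂t² c(x(s), y(t))` at `(0,0)`. -/
noncomputable def crossDiff4 (n : ℕ) (c : Euc n → Euc n → ℝ) (x y : ℝ → Euc n) : ℝ :=
  deriv (deriv (fun s => deriv (deriv (fun t => c (x s) (y t))) 0)) 0

/-- Condition (B3) (= A3w). -/
def B3cond (n : ℕ) (c : Euc n → Euc n → ℝ) (U V : Set (Euc n)) : Prop :=
  ∀ x y : ℝ → Euc n, (∀ t ∈ Icc (-1 : ℝ) 1, x t ∈ closure U) →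
    (∀ t ∈ Icc (-1 : ℝ) 1, y t ∈ closure V) →
    IsAffineSeg n (fun t => (gradY n c (x t) (y 0), gradX n c (x 0) (y t))) →
    crossDiff2 n c x y = 0 → crossDiff4 n c x y ≤ 0

/-- Condition (B4) (non-negative cross-curvature). -/
def B4cond (n : ℕ) (c : Euc n → Euc n → ℝ) (U V : Set (Euc n)) : Prop :=
  ∀ x y : ℝ → Euc n, (∀ t ∈ Icc (-1 : ℝ) 1, x t ∈ closure U) →
    (∀ t ∈ Icc (-1 : ℝ) 1, y t ∈ closure V) →
    IsAffineSeg n (fun t => (gradY n c (x t) (y 0), gradX n c (x 0) (y t))) →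
    crossDiff4 n c x y ≤ 0

/-- The `c*`-transform `u^{c*}(y) = sup_{x ∈ A} (-c(x,y) - u(x))`. -/
noncomputable def cStarT (n : ℕ) (c : Euc n → Euc n → ℝ) (A : Set (Euc n)) (u : Euc n → ℝ)
    (y : Euc n) : ℝ :=
  sSup ((fun x => -c x y - u x) '' A)

/-- `u` is `c`-convex on `A` (relative to the target set `B`): `u = (u^{c*})^c`. -/
def CConvexOn (n : ℕ) (c : Euc n → Euc n → ℝ) (A B : Set (Euc n)) (u : Euc n → ℝ) : Prop :=
  ∀ x ∈ A, u x = sSup ((fun y => -c x y - cStarT n c A u y) '' B)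

/-- The `c`-subdifferential `∂ᶜu ⊂ A × B`. -/
def cSubdiff (n : ℕ) (c : Euc n → Euc n → ℝ) (A B : Set (Euc n)) (u : Euc n → ℝ) :
    Set (Euc n × Euc n) :=
  {p | p.1 ∈ A ∧ p.2 ∈ B ∧ u p.1 + cStarT n c A u p.2 + c p.1 p.2 = 0}

def cSubdiffAt (n : ℕ) (c : Euc n → Euc n → ℝ) (A B : Set (Euc n)) (u : Euc n → ℝ)
    (x : Euc n) : Set (Euc n) :=
  {y | (x, y) ∈ cSubdiff n c A B u}

def cSubdiffImg (n : ℕ) (c : Euc n → Euc n → ℝ) (A B : Set (Euc n)) (u : Euc n → ℝ)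
    (X : Set (Euc n)) : Set (Euc n) :=
  ⋃ x ∈ X, cSubdiffAt n c A B u x

/-- `∂^{c*}u^{c*}(Y) = {x : ∃ y ∈ Y, (x,y) ∈ ∂ᶜu}`. -/
def cSubdiffPre (n : ℕ) (c : Euc n → Euc n → ℝ) (A B : Set (Euc n)) (u : Euc n → ℝ)
    (Y : Set (Euc n)) : Set (Euc n) :=
  {x | ∃ y ∈ Y, (x, y) ∈ cSubdiff n c A B u}

/-- `|∂ᶜu| ≥ lam` on `S`. -/
def MAge (n : ℕ) (c : Euc n → Euc n → ℝ) (A B : Set (Euc n)) (u : Euc n → ℝ) (lam : ℝ)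
    (S : Set (Euc n)) : Prop :=
  ∀ X : Set (Euc n), X ⊆ S → MeasurableSet X →
    ENNReal.ofReal lam * volume X ≤ volume (cSubdiffImg n c A B u X)

/-- `|∂ᶜu| ≤ lam` on `S`. -/
def MAle (n : ℕ) (c : Euc n → Euc n → ℝ) (A B : Set (Euc n)) (u : Euc n → ℝ) (lam : ℝ)
    (S : Set (Euc n)) : Prop :=
  ∀ X : Set (Euc n), X ⊆ S → MeasurableSet X →
    volume (cSubdiffImg n c A B u X) ≤ ENNReal.ofReal lam * volume X

/-- The inverse of the cost-exponential coordinate change `q(x) = -D_y c(x, ȳ)`. -/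
noncomputable def xOf (n : ℕ) (c : Euc n → Euc n → ℝ) (U : Set (Euc n)) (ybar : Euc n) :
    Euc n → Euc n :=
  Function.invFunOn (fun x => -gradY n c x ybar) (closure U)

/-- `cl U_ȳ := -D_y c(cl U, ȳ)`. -/
def clUy (n : ℕ) (c : Euc n → Euc n → ℝ) (U : Set (Euc n)) (ybar : Euc n) : Set (Euc n) :=
  (fun x => -gradY n c x ybar) '' closure U

/-- The modified cost `c̃(q,y) = c(x(q), y) - c(x(q), ȳ)`. -/
noncomputable def modCost (n : ℕ) (c : Euc n → Euc n → ℝ) (U : Set (Euc n)) (ybar : Euc n)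
    (q y : Euc n) : ℝ :=
  c (xOf n c U ybar q) y - c (xOf n c U ybar q) ybar

/-- The modified potential `ũ(q) = u(x(q)) + c(x(q), ȳ)`. -/
noncomputable def modPot (n : ℕ) (c : Euc n → Euc n → ℝ) (U : Set (Euc n)) (ybar : Euc n)
    (u : Euc n → ℝ) (q : Euc n) : ℝ :=
  u (xOf n c U ybar q) + c (xOf n c U ybar q) ybar

/-- The `c̃`-cone generated by `qt` and `Q` with height `-h0 > 0`. -/
noncomputable def cConeFun (n : ℕ) (ct : Euc n → Euc n → ℝ) (B Q : Set (Euc n)) (qt : Euc n)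
    (h0 : ℝ) (q : Euc n) : ℝ :=
  sSup {r : ℝ | ∃ y ∈ B, r = -ct q y + ct qt y + h0 ∧
    ∀ p ∈ frontier Q, -ct p y + ct qt y + h0 ≤ 0}

/-- The ordinary subdifferential `∂u(x)` relative to a domain `A`. -/
def subdiffAt (n : ℕ) (A : Set (Euc n)) (u : Euc n → ℝ) (x : Euc n) : Set (Euc n) :=
  {p | ∀ ε > 0, ∃ δ > 0, ∀ x' ∈ A, ‖x' - x‖ < δ →
    u x + @inner ℝ _ _ p (x' - x) - ε * ‖x' - x‖ ≤ u x'}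

/-- The dual norm `‖v‖*_K = sup_{w ∈ K} ⟨w, v⟩`. -/
noncomputable def dualNorm (n : ℕ) (K : Set (Euc n)) (v : Euc n) : ℝ :=
  sSup ((fun w => (@inner ℝ _ _ w v : ℝ)) '' K)

/-- The section `S(x̄, ȳ, τ)`. -/
def sectS (n : ℕ) (c : Euc n → Euc n → ℝ) (U : Set (Euc n)) (u : Euc n → ℝ)
    (xbar ybar : Euc n) (τ : ℝ) : Set (Euc n) :=
  {x ∈ U | u x ≤ u xbar - c x ybar + c xbar ybar + τ}

/-- The measure with density `f` restricted to `A`. -/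
noncomputable def densMeasure (n : ℕ) (A : Set (Euc n)) (f : Euc n → ℝ) : Measure (Euc n) :=
  (volume.restrict A).withDensity fun x => ENNReal.ofReal (f x)

end

section

open Filter Topology

/-- Mean value inequality along a convex parametrization `g` of the set `T`. -/
lemma mv_param {E F : Type*} [NormedAddCommGroup E] [NormedSpace ℝ E]
    [NormedAddCommGroup F] [NormedSpace ℝ F]
    {T T0 : Set E} {g : E → E} {g' : E → E →L[ℝ] E} {L K : ℝ} {Φ : E → F} {Φ' : E → E →L[ℝ] F}
    (hT0 : Convex ℝ T0) (hg : ∀ p ∈ T0, HasFDerivWithinAt g (g' p) T0 p)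
    (hg' : ∀ p ∈ T0, ‖g' p‖ ≤ L) (hgT : MapsTo g T0 T)
    (hΦ : ∀ y ∈ T, HasFDerivWithinAt Φ (Φ' y) T y) (hK0 : 0 ≤ K)
    {p q : E} (hp : p ∈ T0) (hq : q ∈ T0)
    (hK : ∀ r ∈ T0, ‖r - q‖ ≤ ‖p - q‖ → ‖Φ' (g r)‖ ≤ K) :
    ‖Φ (g p) - Φ (g q)‖ ≤ K * L * ‖p - q‖ := by
  set s := T0 ∩ closedBall q ‖p - q‖ with hs
  have hconv : Convex ℝ s := hT0.inter (convex_closedBall _ _)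
  have h1 : ∀ r ∈ s, HasFDerivWithinAt (fun r => Φ (g r)) ((Φ' (g r)).comp (g' r)) s r := by
    intro r hr
    exact (((hΦ (g r) (hgT hr.1)).comp r (hg r hr.1) hgT)).mono inter_subset_left
  refine hconv.norm_image_sub_le_of_norm_hasFDerivWithin_le h1 ?_ ⟨hq, ?_⟩ ⟨hp, ?_⟩
  · intro r hr
    have := hr.2
    rw [mem_closedBall, dist_eq_norm] at this
    calc _ ≤ ‖Φ' (g r)‖ * ‖g' r‖ := ContinuousLinearMap.opNorm_comp_le _ _
      _ ≤ K * L := by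
        gcongr
        · exact hK r hr.1 this
        · exact hg' r hr.1
  · simp
  · simp [dist_eq_norm]

/-- Second order Taylor estimate along a convex parametrization. -/
lemma taylor_param {E F : Type*} [NormedAddCommGroup E] [NormedSpace ℝ E]
    [NormedAddCommGroup F] [NormedSpace ℝ F]
    {T T0 : Set E} {g : E → E} {g' : E → E →L[ℝ] E} {L η : ℝ} {Φ : E → F} {Φ' : E → E →L[ℝ] F}
    {Φ'' : E → E →L[ℝ] (E →L[ℝ] F)}
    (hT0 : Convex ℝ T0) (hg : ∀ p ∈ T0, HasFDerivWithinAt g (g' p) T0 p)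
    (hg' : ∀ p ∈ T0, ‖g' p‖ ≤ L) (hgT : MapsTo g T0 T)
    (hΦ : ∀ y ∈ T, HasFDerivWithinAt Φ (Φ' y) T y)
    (hΦ' : ∀ y ∈ T, HasFDerivWithinAt Φ' (Φ'' y) T y) (hη0 : 0 ≤ η)
    (hη : ∀ y ∈ T, ‖Φ'' y‖ ≤ η)
    {p q : E} (hp : p ∈ T0) (hq : q ∈ T0) (h0 : Φ' (g q) = 0) :
    ‖Φ (g p) - Φ (g q)‖ ≤ η * L ^ 2 * ‖p - q‖ ^ 2 := by
  have hL : 0 ≤ L := (norm_nonneg _).trans (hg' p hp)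
  have := mv_param (K := η * L * ‖p - q‖) hT0 hg hg' hgT hΦ (by positivity) hp hq ?_
  · linarith
  · intro r hr hrp
    have h2 := mv_param (K := η) hT0 hg hg' hgT hΦ' hη0 hr hq (fun r hr _ => hη _ (hgT hr))
    rw [h0, sub_zero] at h2
    exact h2.trans (by gcongr)

lemma inv_of_comp_id {n : ℕ} {A B : Euc n →L[ℝ] Euc n}
    (h : A.comp B = ContinuousLinearMap.id ℝ _) :
    B.comp A = ContinuousLinearMap.id ℝ _ := by
  have h1 : (A : Euc n →ₗ[ℝ] Euc n) * (B : Euc n →ₗ[ℝ] Euc n) = 1 := by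
    ext1 v; exact congrArg (fun T => T v) h
  have h2 := mul_eq_one_comm.1 h1
  ext1 v
  exact congrArg (fun T => T v) h2

/-- Geometry of the target in the coordinates given by a diffeomorphism onto a convex set. -/
lemma geom {n : ℕ} {f : Euc n → Euc n} {V : Set (Euc n)} (hV : IsOpen V) (hVb : IsBounded V)
    (hne : V.Nonempty) (hf : DiffeoOnto n f (closure V)) (hc : Convex ℝ (f '' V)) :
    ∃ (T0 : Set (Euc n)) (g : Euc n → Euc n) (g' : Euc n → Euc n →L[ℝ] Euc n) (L : ℝ),
      T0 = f '' closure V ∧ Convex ℝ T0 ∧ 0 < L ∧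
      T0 ⊆ closure (f '' V) ∧
      (∀ p ∈ T0, HasFDerivWithinAt g (g' p) T0 p) ∧ (∀ p ∈ T0, ‖g' p‖ ≤ L) ∧
      MapsTo g T0 (closure V) ∧ (∀ y ∈ closure V, g (f y) = y) ∧
      UniqueDiffOn ℝ (closure V) ∧
      (∀ y ∈ closure V, ∀ M : Euc n →L[ℝ] Euc n, HasFDerivWithinAt f M (closure V) y →
        M.IsInvertible) := by
  obtain ⟨hinj, hf1, hg1⟩ := hf
  set g := Function.invFunOn f (closure V) with hgdef
  set T0 := f '' closure V with hT0
  have hgf : ∀ y ∈ closure V, g (f y) = y := fun y hy => hinj.leftInvOn_invFunOn hy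
  have hcomp : IsCompact (closure V) := hVb.isCompact_closure
  have hcompT0 : IsCompact T0 := hcomp.image_of_continuousOn hf1.continuousOn
  have hsub : T0 ⊆ closure (f '' V) := by
    have := hf1.continuousOn.image_closure (s := V)
    exact this
  have hT0eq : T0 = closure (f '' V) :=
    hsub.antisymm (closure_minimal (image_mono subset_closure) hcompT0.isClosed)
  have hT0c : Convex ℝ T0 := hT0eq ▸ hc.closure
  have hgT : MapsTo g T0 (closure V) := by
    rintro _ ⟨y, hy, rfl⟩; rw [hgf y hy]; exact hy
  have hfg : ∀ p ∈ T0, f (g p) = p := by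
    rintro _ ⟨y, hy, rfl⟩; rw [hgf y hy]
  have hgd : ∀ p ∈ T0, HasFDerivWithinAt g (fderivWithin ℝ g T0 p) T0 p := fun p hp =>
    (hg1.differentiableOn one_ne_zero p hp).hasFDerivWithinAt
  have hfd : ∀ p ∈ closure V, HasFDerivWithinAt f (fderivWithin ℝ f (closure V) p) (closure V) p :=
    fun p hp => (hf1.differentiableOn one_ne_zero p hp).hasFDerivWithinAt
  -- nonempty interior
  have hXint : (interior T0).Nonempty := by
    obtain ⟨y0, hy0⟩ := hne
    have hy0c := subset_closure hy0
    have hnh : closure V ∈ 𝓝 y0 := mem_of_superset (hV.mem_nhds hy0) subset_closure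
    have hcd : ContDiffAt ℝ 1 f y0 := hf1.contDiffAt hnh
    have hs := hcd.hasStrictFDerivAt one_ne_zero
    have hG := hgd (f y0) (mem_image_of_mem f hy0c)
    have hco := hG.comp y0 (hs.hasFDerivAt.hasFDerivWithinAt (s := closure V))
      (mapsTo_image f (closure V))
    have hco2 := hco.hasFDerivAt hnh
    have hid : HasFDerivAt (g ∘ f) (ContinuousLinearMap.id ℝ (Euc n)) y0 := by
      refine (hasFDerivAt_id y0).congr_of_eventuallyEq ?_
      filter_upwards [hnh] with y hy using hgf y hy
    have h1 := hco2.unique hid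
    have h2 := inv_of_comp_id h1
    let e : Euc n ≃L[ℝ] Euc n := ContinuousLinearEquiv.equivOfInverse (fderiv ℝ f y0)
      (fderivWithin ℝ g T0 (f y0)) (fun v => congrArg (fun T => T v) h1)
      (fun v => congrArg (fun T => T v) h2)
    have hs' : HasStrictFDerivAt f (e : Euc n →L[ℝ] Euc n) y0 := hs
    have hm := hs'.map_nhds_eq_of_equiv
    refine ⟨f y0, ?_⟩
    rw [mem_interior_iff_mem_nhds, ← hm]
    exact image_mem_map hnh
  have hU0 : UniqueDiffOn ℝ T0 := uniqueDiffOn_convex hT0c hXint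
  have hM : ∀ y ∈ closure V, ∀ M : Euc n →L[ℝ] Euc n, HasFDerivWithinAt f M (closure V) y →
      M.comp (fderivWithin ℝ g T0 (f y)) = ContinuousLinearMap.id ℝ _ := by
    intro y hy M hM
    have hmem : f y ∈ T0 := mem_image_of_mem f hy
    have hM' : HasFDerivWithinAt f M (closure V) (g (f y)) := by rwa [hgf y hy]
    have h1 := hM'.comp (f y) (hgd _ hmem) hgT
    have h2 : HasFDerivWithinAt (f ∘ g) (ContinuousLinearMap.id ℝ (Euc n)) T0 (f y) :=
      (hasFDerivWithinAt_id _ _).congr (fun p hp => hfg p hp) (hfg _ hmem)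
    exact (hU0 _ hmem).eq h1 h2
  have hgc : ContinuousOn (fun p => fderivWithin ℝ g T0 p) T0 :=
    hg1.continuousOn_fderivWithin hU0 (le_refl _)
  obtain ⟨L, hL⟩ := hcompT0.exists_bound_of_continuousOn hgc
  refine ⟨T0, g, fderivWithin ℝ g T0, max L 1, rfl, hT0c, by positivity, hsub, hgd,
    fun p hp => (hL p hp).trans (le_max_left _ _), hgT, hgf, ?_, ?_⟩
  · intro y hy
    have hmem : f y ∈ T0 := mem_image_of_mem f hy
    have h1 := inv_of_comp_id (hM y hy _ (hfd y hy))
    have h2 := (hgd _ hmem).uniqueDiffWithinAt (hU0 _ hmem) (Function.Surjective.denseRange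
      (fun v => ⟨_, congrArg (fun T => T v) h1⟩))
    rw [hgf y hy] at h2
    refine h2.mono ?_
    exact hgT.image_subset
  · intro y hy M hMd
    exact ContinuousLinearMap.IsInvertible.of_inverse (hM y hy M hMd)
      (inv_of_comp_id (hM y hy M hMd))

/-- The curve issued from `xb` along which the `c`-subdifferential has to shrink to `yb`. -/
lemma curve {n : ℕ} {c : Euc n → Euc n → ℝ} {W T T0 : Set (Euc n)}
    {P : Euc n → Euc n → Euc n} {P1 : Euc n × Euc n → Euc n →L[ℝ] Euc n}
    {P2 : Euc n × Euc n → Euc n →L[ℝ] Euc n →L[ℝ] Euc n}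
    {xb yb e : Euc n} {g : Euc n → Euc n} {g' : Euc n → Euc n →L[ℝ] Euc n} {L : ℝ}
    (hW : IsOpen W) (hT : IsCompact T) (hxb : xb ∈ W) (hyb : yb ∈ T)
    (hc : ∀ x ∈ W, ∀ y ∈ T, HasFDerivAt (fun x' => -c x' y) (innerSL ℝ (P x y)) x)
    (hP1 : ∀ x ∈ W, ∀ y ∈ T, HasFDerivWithinAt (P x) (P1 (x, y)) T y)
    (hP2 : ∀ x ∈ W, ∀ y ∈ T, HasFDerivWithinAt (fun y' => P1 (x, y')) (P2 (x, y)) T y)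
    (hP1c : ContinuousOn P1 (W ×ˢ T)) (hP2c : ContinuousOn P2 (W ×ˢ T))
    (hP1d : ContDiffAt ℝ 1 (fun x => P1 (x, yb)) xb)
    (hinv : (P1 (xb, yb)).IsInvertible)
    (hT0 : Convex ℝ T0) (hL : 0 < L) (hT0f : T0 = P xb '' T)
    (hg : ∀ p ∈ T0, HasFDerivWithinAt g (g' p) T0 p)
    (hg' : ∀ p ∈ T0, ‖g' p‖ ≤ L) (hgT : MapsTo g T0 T) (hgf : ∀ y ∈ T, g (P xb y) = y)
    (he : ∀ y ∈ T, inner ℝ e (P xb y - P xb yb) ≤ -(1/2) * ‖P xb y - P xb yb‖ ^ 2) :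
    ∃ r > 0, ball xb r ⊆ W ∧ ∃ C ≥ 0, ∃ ε > 0, ∃ γ : ℝ → Euc n, γ 0 = xb ∧
      (∀ t ∈ Icc 0 ε, γ t ∈ ball xb r) ∧
      (∀ y ∈ T, ∀ s t, 0 ≤ s → s ≤ t → t ≤ ε →
        (-c (γ t) y + c (γ t) yb) - (-c (γ s) y + c (γ s) yb)
          ≤ -(1/4) * (t - s) * ‖P xb y - P xb yb‖ ^ 2) ∧
      (∀ y ∈ T, ∀ x ∈ ball xb r, ∀ x' ∈ ball xb r,
        (-c x' y + c x' yb) - (-c x y + c x yb) ≤ C * ‖x' - x‖ * ‖P xb y - P xb yb‖) := by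
  have hWn : W ∈ 𝓝 xb := hW.mem_nhds hxb
  have hmem : ∀ y ∈ T, P xb y ∈ T0 := fun y hy => hT0f ▸ mem_image_of_mem _ hy
  -- the vector field
  set ξ : Euc n → Euc n := fun x => (InnerProductSpace.toDual ℝ (Euc n)).symm
    (((innerSL ℝ e).comp (P1 (xb, yb))).comp (P1 (x, yb)).inverse) with hξ
  have hξin : ∀ x v, inner ℝ (ξ x) v = inner ℝ e (P1 (xb, yb) ((P1 (x, yb)).inverse v)) := by
    intro x v
    simp [hξ, InnerProductSpace.toDual_symm_apply]
  have hξd : ContDiffAt ℝ 1 ξ xb := by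
    have h1 : ContDiffAt ℝ 1 (fun x => (P1 (x, yb)).inverse) xb :=
      ContDiffAt.comp xb (f := fun x => P1 (x, yb)) (g := ContinuousLinearMap.inverse)
        hinv.contDiffAt_map_inverse hP1d
    have h2 : ContDiffAt ℝ 1 (fun x =>
      ((innerSL ℝ e).comp (P1 (xb, yb))).comp (P1 (x, yb)).inverse) xb :=
      contDiffAt_const.clm_comp h1
    exact ((InnerProductSpace.toDual ℝ (Euc n)).symm.toContinuousLinearEquiv.contDiff.contDiffAt).comp
      xb h2
  have hξb : ξ xb = e := by
    refine ext_inner_right ℝ fun v => ?_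
    rw [hξin, hinv.self_apply_inverse]
  -- second derivative of the auxiliary function
  set Φ'' : Euc n → Euc n → Euc n →L[ℝ] Euc n →L[ℝ] ℝ := fun x y =>
    (ContinuousLinearMap.compL ℝ (Euc n) (Euc n) ℝ (innerSL ℝ (ξ x))).comp (P2 (x, y)) -
    (ContinuousLinearMap.compL ℝ (Euc n) (Euc n) ℝ (innerSL ℝ e)).comp (P2 (xb, y)) with hΦ''
  set η : ℝ := 1 / (4 * L ^ 2) with hη
  have hη0 : 0 < η := by positivity
  have hξc : ContinuousAt ξ xb := hξd.continuousAt
  have hev : ∀ᶠ x in 𝓝 xb, ∀ y ∈ T, y ∈ T → ‖Φ'' x y‖ < η := by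
    refine hT.eventually_forall_of_forall_eventually (P := fun x y => y ∈ T → ‖Φ'' x y‖ < η) ?_
    intro y hy
    have hct : ContinuousWithinAt (fun z : Euc n × Euc n => Φ'' z.1 z.2) (W ×ˢ T) (xb, y) := by
      have c1 : ContinuousWithinAt (fun z : Euc n × Euc n => ξ z.1) (W ×ˢ T) (xb, y) :=
        (ContinuousAt.comp (f := Prod.fst) (x := (xb, y)) hξc continuousAt_fst).continuousWithinAt
      have c2 := hP2c (xb, y) ⟨hxb, hy⟩
      have c3 : ContinuousWithinAt (fun z : Euc n × Euc n => P2 (xb, z.2)) (W ×ˢ T) (xb, y) := by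
        refine ContinuousWithinAt.comp (t := W ×ˢ T) (f := fun z : Euc n × Euc n => (xb, z.2))
          c2 (by fun_prop) ?_
        intro z hz; exact ⟨hxb, hz.2⟩
      have c4 : ContinuousWithinAt (fun z : Euc n × Euc n =>
          ContinuousLinearMap.compL ℝ (Euc n) (Euc n) ℝ (innerSL ℝ (ξ z.1))) (W ×ˢ T) (xb, y) :=
        ((ContinuousLinearMap.compL ℝ (Euc n) (Euc n) ℝ).continuous.comp
          (innerSL ℝ).continuous).continuousAt.comp_continuousWithinAt c1
      exact (c4.clm_comp c2).sub (continuousWithinAt_const.clm_comp c3)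
    have h0 : Φ'' xb y = 0 := by simp [hΦ'', hξb]
    have h1 : ∀ᶠ z in 𝓝[W ×ˢ T] (xb, y), ‖Φ'' z.1 z.2‖ < η := by
      have hct2 : Tendsto (fun z : Euc n × Euc n => Φ'' z.1 z.2) (𝓝[W ×ˢ T] (xb, y))
          (𝓝 (Φ'' xb y)) := hct
      have hct3 : Tendsto (fun z : Euc n × Euc n => ‖Φ'' z.1 z.2‖) (𝓝[W ×ˢ T] (xb, y))
          (𝓝 ‖Φ'' xb y‖) := (continuous_norm.tendsto (Φ'' xb y)).comp hct2
      have hn : ‖Φ'' xb y‖ = 0 := by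
        rw [h0]; exact norm_zero (E := Euc n →L[ℝ] Euc n →L[ℝ] ℝ)
      rw [hn] at hct3
      exact hct3.eventually_lt_const hη0
    have h2 := eventually_nhdsWithin_iff.1 h1
    have h3 : ∀ᶠ z : Euc n × Euc n in 𝓝 (xb, y), z.1 ∈ W := continuousAt_fst.eventually hWn
    filter_upwards [h2, h3] with z hz hz1 hz2 using hz ⟨hz1, hz2⟩
  have hevinv : ∀ᶠ x in 𝓝 xb, (P1 (x, yb)).IsInvertible := by
    have : {A : Euc n →L[ℝ] Euc n | A.IsInvertible} ∈ 𝓝 (P1 (xb, yb)) :=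
      ContinuousLinearEquiv.isOpen.mem_nhds hinv
    exact hP1d.continuousAt.eventually this
  obtain ⟨r0, hr0, hball0⟩ := Metric.eventually_nhds_iff_ball.1 ((hev.and hevinv).and
    (show ∀ᶠ x in 𝓝 xb, x ∈ W from hWn))
  set r := r0 / 2 with hr
  have hrpos : 0 < r := by positivity
  have hcb : closedBall xb r ⊆ ball xb r0 := closedBall_subset_ball (by linarith)
  have hcbW : closedBall xb r ⊆ W := fun x hx => (hball0 x (hcb hx)).2
  -- bound on the first derivative
  obtain ⟨K, hK⟩ := ((isCompact_closedBall xb r).prod hT).exists_bound_of_continuousOn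
    (hP1c.mono (prod_mono hcbW Subset.rfl))
  have hK0 : 0 ≤ K := (norm_nonneg _).trans (hK (xb, yb) ⟨mem_closedBall_self hrpos.le, hyb⟩)
  -- key differential inequality
  have hkey : ∀ x ∈ ball xb r, ∀ y ∈ T,
      inner ℝ (ξ x) (P x y - P x yb) ≤ -(1/4) * ‖P xb y - P xb yb‖ ^ 2 := by
    intro x hx y hy
    obtain ⟨⟨hx1, hx2⟩, hxW⟩ := hball0 x (hcb (ball_subset_closedBall hx))
    set Φ : Euc n → ℝ := fun y => innerSL ℝ (ξ x) (P x y) - innerSL ℝ e (P xb y) with hΦ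
    set Φ' : Euc n → Euc n →L[ℝ] ℝ := fun y =>
      (innerSL ℝ (ξ x)).comp (P1 (x, y)) - (innerSL ℝ e).comp (P1 (xb, y)) with hΦ'
    have d1 : ∀ y ∈ T, HasFDerivWithinAt Φ (Φ' y) T y := fun y hy =>
      ((innerSL ℝ (ξ x)).hasFDerivAt.comp_hasFDerivWithinAt y (hP1 x hxW y hy)).sub
      ((innerSL ℝ e).hasFDerivAt.comp_hasFDerivWithinAt y (hP1 xb hxb y hy))
    have d2 : ∀ y ∈ T, HasFDerivWithinAt Φ' (Φ'' x y) T y := fun y hy =>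
      ((ContinuousLinearMap.compL ℝ (Euc n) (Euc n) ℝ
        (innerSL ℝ (ξ x))).hasFDerivAt.comp_hasFDerivWithinAt y (hP2 x hxW y hy)).sub
      ((ContinuousLinearMap.compL ℝ (Euc n) (Euc n) ℝ
        (innerSL ℝ e)).hasFDerivAt.comp_hasFDerivWithinAt y (hP2 xb hxb y hy))
    have h0 : Φ' (g (P xb yb)) = 0 := by
      rw [hgf yb hyb]
      ext1 v
      simp [hΦ', hξin, hx2.inverse_apply_self]
    have := taylor_param hT0 hg hg' hgT d1 d2 hη0.le (fun y hy => (hx1 y hy hy).le)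
      (hmem y hy) (hmem yb hyb) h0
    rw [hgf y hy, hgf yb hyb] at this
    have hηL : η * L ^ 2 = 1 / 4 := by rw [hη]; field_simp
    rw [hηL] at this
    have h1 := (abs_le.1 (Real.norm_eq_abs _ ▸ this)).2
    have h2 := he y hy
    simp only [hΦ, innerSL_apply_apply] at h1
    rw [inner_sub_right] at h2 ⊢
    linarith
  obtain ⟨γ, hγ0, ε0, hε0, hγ⟩ :=
    hξd.exists_forall_mem_closedBall_exists_eq_forall_mem_Ioo_hasDerivAt₀ 0
  have hγc : ContinuousAt γ 0 := (hγ 0 (by constructor <;> linarith)).continuousAt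
  obtain ⟨ε1, hε1, hball1⟩ := Metric.eventually_nhds_iff_ball.1
    (hγc.eventually (show ball xb r ∈ 𝓝 (γ 0) from hγ0 ▸ ball_mem_nhds _ hrpos))
  set ε := min ε0 ε1 / 2 with hε
  have hεpos : 0 < ε := by positivity
  have hεl0 : ε < ε0 := by have := min_le_left ε0 ε1; linarith
  have hεl1 : ε < ε1 := by have := min_le_right ε0 ε1; linarith
  have hγb : ∀ t ∈ Icc 0 ε, γ t ∈ ball xb r := by
    intro t ht
    apply hball1
    rw [mem_ball, Real.dist_eq, sub_zero, abs_of_nonneg ht.1]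
    linarith [ht.2]
  refine ⟨r, hrpos, fun x hx => hcbW (ball_subset_closedBall hx), K * L, by positivity, ε, hεpos, γ,
    hγ0, hγb, ?_, ?_⟩
  · intro y hy s t hs hst ht
    set ρ := ‖P xb y - P xb yb‖
    have hd : ∀ τ ∈ Icc 0 ε, HasDerivAt (fun τ => -c (γ τ) y + c (γ τ) yb)
        (inner ℝ (ξ (γ τ)) (P (γ τ) y - P (γ τ) yb)) τ := by
      intro τ hτ
      have hW' := hcbW (ball_subset_closedBall (hγb τ hτ))
      have hγτ := hγ τ ⟨by linarith [hτ.1], by linarith [hτ.2]⟩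
      have e1 := (hc _ hW' y hy).comp_hasDerivAt τ hγτ
      have e2 := (hc _ hW' yb hyb).comp_hasDerivAt τ hγτ
      have e3 := e1.sub e2
      have hfun : (fun τ => -c (γ τ) y + c (γ τ) yb) =
          (fun x' => -c x' y) ∘ γ - (fun x' => -c x' yb) ∘ γ := by
        funext τ
        simp only [Pi.sub_apply, Function.comp_apply]
        ring
      have hval : inner ℝ (ξ (γ τ)) (P (γ τ) y - P (γ τ) yb) =
          innerSL ℝ (P (γ τ) y) (ξ (γ τ)) - innerSL ℝ (P (γ τ) yb) (ξ (γ τ)) := by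
        rw [innerSL_apply_apply, innerSL_apply_apply, inner_sub_right,
          real_inner_comm (ξ (γ τ)), real_inner_comm (ξ (γ τ))]
      rw [hfun, hval]
      exact e3
    have hsub : ∀ τ ∈ Icc s t, τ ∈ Icc 0 ε := fun τ hτ => ⟨hs.trans hτ.1, hτ.2.trans ht⟩
    have := image_le_of_deriv_right_le_deriv_boundary
      (f := fun τ => -c (γ τ) y + c (γ τ) yb)
      (f' := fun τ => inner ℝ (ξ (γ τ)) (P (γ τ) y - P (γ τ) yb)) (a := s) (b := t)
      (fun τ hτ => (hd τ (hsub τ hτ)).continuousAt.continuousWithinAt)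
      (fun τ hτ => (hd τ (hsub τ (Ico_subset_Icc_self hτ))).hasDerivWithinAt)
      (B := fun τ => (-c (γ s) y + c (γ s) yb) + (τ - s) * (-(1/4) * ρ ^ 2))
      (B' := fun τ => -(1/4) * ρ ^ 2) (by simp) (by fun_prop)
      (fun τ _ => by
        have := (((hasDerivAt_id τ).sub_const s).mul_const (-(1/4) * ρ ^ 2)).const_add
          (-c (γ s) y + c (γ s) yb)
        simpa using this.hasDerivWithinAt)
      (fun τ hτ => hkey _ (hγb τ (hsub τ (Ico_subset_Icc_self hτ))) y hy)
      (right_mem_Icc.2 hst)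
    linarith
  · intro y hy x hx x' hx'
    set ρ := ‖P xb y - P xb yb‖
    have hd : ∀ z ∈ ball xb r, HasFDerivWithinAt (fun x => -c x y + c x yb)
        (innerSL ℝ (P z y) - innerSL ℝ (P z yb)) (ball xb r) z := by
      intro z hz
      have hW' := hcbW (ball_subset_closedBall hz)
      have e3 := (hc _ hW' y hy).sub (hc _ hW' yb hyb)
      have : (fun x => -c x y + c x yb) = ((fun x' => -c x' y) - fun x' => -c x' yb) := by
        funext z
        simp only [Pi.sub_apply]
        ring
      rw [this]
      exact e3.hasFDerivWithinAt
    have hbd : ∀ z ∈ ball xb r, ‖innerSL ℝ (P z y) - innerSL ℝ (P z yb)‖ ≤ K * L * ρ := by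
      intro z hz
      have hW' := hcbW (ball_subset_closedBall hz)
      rw [← map_sub, innerSL_apply_norm]
      have := mv_param hT0 hg hg' hgT (hP1 z hW') hK0 (hmem y hy) (hmem yb hyb)
        (fun r hr _ => hK (z, g r) ⟨ball_subset_closedBall hz, hgT hr⟩)
      rwa [hgf y hy, hgf yb hyb] at this
    have := (convex_ball xb r).norm_image_sub_le_of_norm_hasFDerivWithin_le hd hbd hx hx'
    have h2 := (abs_le.1 (Real.norm_eq_abs _ ▸ this)).2
    linarith

/-- Regularity of `-D_x c` on `W × T`. -/
lemma derivs {n : ℕ} {c : Euc n → Euc n → ℝ} {W T : Set (Euc n)} (hW : IsOpen W)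
    (hT : UniqueDiffOn ℝ T) (hC : ContDiffOn ℝ 4 (Function.uncurry c) (W ×ˢ T)) :
    ∃ (P1 : Euc n × Euc n → Euc n →L[ℝ] Euc n)
      (P2 : Euc n × Euc n → Euc n →L[ℝ] Euc n →L[ℝ] Euc n),
      (∀ x ∈ W, ∀ y ∈ T, HasFDerivAt (fun x' => -c x' y) (innerSL ℝ (-gradX n c x y)) x) ∧
      (∀ x ∈ W, ∀ y ∈ T, HasFDerivWithinAt (fun y => -gradX n c x y) (P1 (x, y)) T y) ∧
      (∀ x ∈ W, ∀ y ∈ T, HasFDerivWithinAt (fun y' => P1 (x, y')) (P2 (x, y)) T y) ∧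
      ContinuousOn P1 (W ×ˢ T) ∧ ContinuousOn P2 (W ×ˢ T) ∧
      (∀ x ∈ W, ∀ y ∈ T, ContDiffAt ℝ 1 (fun x => P1 (x, y)) x) := by
  set S := W ×ˢ T with hS
  have hSu : UniqueDiffOn ℝ S := hW.uniqueDiffOn.prod hT
  have hright : ∀ {G : Type} [NormedAddCommGroup G] [NormedSpace ℝ G] (F : Euc n × Euc n → G),
      DifferentiableOn ℝ F S → ∀ x ∈ W, ∀ y ∈ T,
      HasFDerivWithinAt (fun y' => F (x, y'))
        ((fderivWithin ℝ F S (x, y)).comp (ContinuousLinearMap.inr ℝ (Euc n) (Euc n))) T y := by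
    intro G _ _ F hF x hx y hy
    have h1 := (hF (x, y) ⟨hx, hy⟩).hasFDerivWithinAt
    exact h1.comp y (hasFDerivAt_prodMk_right x y).hasFDerivWithinAt
      (fun y' hy' => ⟨hx, hy'⟩)
  have hgrad : ∀ x ∈ W, ∀ y ∈ T, HasFDerivAt (fun x' => c x' y)
      ((fderivWithin ℝ (Function.uncurry c) S (x, y)).comp
        (ContinuousLinearMap.inl ℝ (Euc n) (Euc n))) x := by
    intro x hx y hy
    have h1 := ((hC.differentiableOn (by norm_num)) (x, y) ⟨hx, hy⟩).hasFDerivWithinAt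
    have h2 := HasFDerivWithinAt.comp (g := Function.uncurry c) (f := fun x' => (x', y)) (t := S)
      (s := W) x h1 (hasFDerivAt_prodMk_left x y).hasFDerivWithinAt (fun x' hx' => ⟨hx', hy⟩)
    exact HasFDerivWithinAt.hasFDerivAt (f := fun x' => c x' y) h2 (hW.mem_nhds hx)
  set Pj : Euc n × Euc n → Euc n := fun z => -gradX n c z.1 z.2 with hPj
  have hPjc : ContDiffOn ℝ 3 Pj S := by
    have h1 : ContDiffOn ℝ 3 (fderivWithin ℝ (Function.uncurry c) S) S :=
      hC.fderivWithin hSu (by norm_num)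
    have h2 : ContDiffOn ℝ 3 (fun z => (fderivWithin ℝ (Function.uncurry c) S z).comp
        (ContinuousLinearMap.inl ℝ (Euc n) (Euc n))) S := h1.clm_comp contDiffOn_const
    have h3 : ContDiffOn ℝ 3 (fun z => -(InnerProductSpace.toDual ℝ (Euc n)).symm
        ((fderivWithin ℝ (Function.uncurry c) S z).comp
        (ContinuousLinearMap.inl ℝ (Euc n) (Euc n)))) S :=
      (((InnerProductSpace.toDual ℝ
        (Euc n)).symm.toContinuousLinearEquiv.contDiff).comp_contDiffOn h2).neg
    refine h3.congr ?_
    rintro ⟨x, y⟩ ⟨hx, hy⟩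
    simp only [hPj, gradX, gradient]
    rw [(hgrad x hx y hy).fderiv]
  set P1 : Euc n × Euc n → Euc n →L[ℝ] Euc n := fun z =>
    (fderivWithin ℝ Pj S z).comp (ContinuousLinearMap.inr ℝ (Euc n) (Euc n)) with hP1
  have hP1c : ContDiffOn ℝ 2 P1 S :=
    (hPjc.fderivWithin hSu (by norm_num)).clm_comp contDiffOn_const
  set P2 : Euc n × Euc n → Euc n →L[ℝ] Euc n →L[ℝ] Euc n := fun z =>
    (fderivWithin ℝ P1 S z).comp (ContinuousLinearMap.inr ℝ (Euc n) (Euc n)) with hP2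
  have hP2c : ContDiffOn ℝ 1 P2 S :=
    (hP1c.fderivWithin hSu (by norm_num)).clm_comp contDiffOn_const
  refine ⟨P1, P2, ?_, ?_, ?_, hP1c.continuousOn, hP2c.continuousOn, ?_⟩
  · intro x hx y hy
    have h1 := (hgrad x hx y hy).differentiableAt.hasGradientAt.hasFDerivAt.neg
    refine h1.congr_fderiv ?_
    ext1 v
    simp [gradX]
  · exact hright Pj (hPjc.differentiableOn (by norm_num))
  · exact hright P1 (hP1c.differentiableOn (by norm_num))
  · intro x hx y hy
    have h1 : ContDiffOn ℝ 2 (fun x => P1 (x, y)) W :=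
      hP1c.comp (f := fun x => (x, y)) (by fun_prop) (fun x' hx' => ⟨hx', hy⟩)
    exact (h1.contDiffAt (hW.mem_nhds hx)).of_le (by norm_num)

/-- The Fenchel-Young type inequality: the supremum defining `u^{c*}` is a genuine one. -/
lemma fenchel {n : ℕ} {c : Euc n → Euc n → ℝ} {A B : Set (Euc n)} {u : Euc n → ℝ}
    (hA : IsCompact A) (hB : IsCompact B)
    (hc : ContinuousOn (Function.uncurry c) (A ×ˢ B)) (hu : CConvexOn n c A B u) :
    ∀ x ∈ A, ∀ y ∈ B, -c x y - u x ≤ cStarT n c A u y := by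
  obtain ⟨K, hK⟩ := (hA.prod hB).exists_bound_of_continuousOn hc
  have hK' : ∀ x ∈ A, ∀ y ∈ B, |c x y| ≤ K := fun x hx y hy => hK (x, y) ⟨hx, hy⟩
  have hbdd : ∀ y ∈ B, BddAbove ((fun x => -c x y - u x) '' A) := by
    intro y hy
    by_contra hn
    have hnall : ∀ y' ∈ B, ¬ BddAbove ((fun x => -c x y' - u x) '' A) := by
      rintro y' hy' ⟨M, hM⟩
      refine hn ⟨M + 2 * K, ?_⟩
      rintro _ ⟨x, hx, rfl⟩
      have h1 := hM ⟨x, hx, rfl⟩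
      have h2 := abs_le.1 (hK' x hx y hy)
      have h3 := abs_le.1 (hK' x hx y' hy')
      change -c x y - u x ≤ M + 2 * K
      change -c x y' - u x ≤ M at h1
      linarith [h2.1, h3.2]
    refine hn ⟨2 * K, ?_⟩
    rintro _ ⟨x, hx, rfl⟩
    have h0 : ∀ y' ∈ B, cStarT n c A u y' = 0 := fun y' hy' =>
      Real.sSup_of_not_bddAbove (hnall y' hy')
    have h1 : -c x y - cStarT n c A u y ≤ u x := by
      rw [hu x hx]
      refine le_csSup ⟨K, ?_⟩ ⟨y, hy, rfl⟩
      rintro _ ⟨y', hy', rfl⟩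
      have := abs_le.1 (hK' x hx y' hy')
      simp only [h0 y' hy']
      linarith [this.1]
    rw [h0 y hy] at h1
    have h2 := abs_le.1 (hK' x hx y hy)
    change -c x y - u x ≤ 2 * K
    linarith [h2.1, h2.2]
  intro x hx y hy
  exact le_csSup (hbdd y hy) ⟨x, hx, rfl⟩

/-- Volume comparison: infinitely many disjoint small balls cannot be squeezed into one ball. -/
lemma vol_contra {n : ℕ} {lam D r : ℝ} (hlam : 0 < lam) (hD : 0 ≤ D) {xb yb : Euc n}
    {ν : Set (Euc n) → Set (Euc n)} {x : ℕ → Euc n} (hx : Function.Injective x)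
    (hxr : ∀ i, x i ∈ ball xb r)
    (h1 : ∀ s, s ⊆ ball xb r → MeasurableSet s → ENNReal.ofReal lam * volume s ≤ volume (ν s))
    (h2 : ∀ δ > 0, ∀ s, s ⊆ ball xb r → (∀ z ∈ s, ∃ i, dist z (x i) < δ) →
      ν s ⊆ closedBall yb (D * δ)) : False := by
  set d := Module.finrank ℝ (Euc n) with hd
  obtain ⟨N, hN⟩ := exists_nat_gt (D ^ d / lam)
  rw [div_lt_iff₀ hlam] at hN
  obtain ⟨O, hO, hOd⟩ := Set.Finite.t2_separation
    ((Set.finite_lt_nat N).image x)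
  have hev : ∀ᶠ δ in 𝓝[>] (0 : ℝ), ∀ i ∈ Finset.range N, ball (x i) δ ⊆ O (x i) ∩ ball xb r := by
    rw [Filter.eventually_all_finset]
    intro i _
    have hn : O (x i) ∩ ball xb r ∈ 𝓝 (x i) :=
      inter_mem ((hO (x i)).2.mem_nhds (hO (x i)).1) (isOpen_ball.mem_nhds (hxr i))
    obtain ⟨a, ha, hab⟩ := Metric.mem_nhds_iff.1 hn
    filter_upwards [Ioo_mem_nhdsGT ha] with δ hδ
    exact (ball_subset_ball hδ.2.le).trans hab
  obtain ⟨δ, hδ, hδ0⟩ := (hev.and self_mem_nhdsWithin).exists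
  have hδ0 : 0 < δ := hδ0
  set s : Set (Euc n) := ⋃ i ∈ Finset.range N, ball (x i) δ with hs
  have hsub : s ⊆ ball xb r := by
    refine iUnion₂_subset fun i hi => (hδ i hi).trans inter_subset_right
  have hvs : volume s = N * (ENNReal.ofReal (δ ^ d) * volume (ball (0 : Euc n) 1)) := by
    rw [hs, measure_biUnion_finset]
    · rw [Finset.sum_congr rfl (fun i _ => Measure.addHaar_ball_of_pos volume (x i) hδ0),
        Finset.sum_const, Finset.card_range, nsmul_eq_mul]
    · intro i hi j hj hij
      have hi' : i ∈ {k | k < N} := by simpa using hi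
      have hj' : j ∈ {k | k < N} := by simpa using hj
      exact (hOd (mem_image_of_mem x hi') (mem_image_of_mem x hj') (fun h => hij (hx h))).mono
        ((hδ i hi).trans inter_subset_left) ((hδ j hj).trans inter_subset_left)
    · intro i _; exact measurableSet_ball
  have hle := h1 s hsub (Finset.measurableSet_biUnion _ fun i _ => measurableSet_ball)
  have hin := h2 δ hδ0 s hsub (by
    intro z hz
    simp only [hs, mem_iUnion] at hz
    obtain ⟨i, _, hi⟩ := hz
    exact ⟨i, hi⟩)
  have hle2 := hle.trans (measure_mono hin)
  rw [hvs, Measure.addHaar_closedBall _ _ (by positivity), ← mul_assoc, ← mul_assoc] at hle2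
  have hb0 : volume (ball (0 : Euc n) 1) ≠ 0 := (measure_ball_pos _ _ one_pos).ne'
  have hb1 : volume (ball (0 : Euc n) 1) ≠ ⊤ := measure_ball_lt_top.ne
  rw [ENNReal.mul_le_mul_iff_left hb0 hb1, ← ENNReal.ofReal_natCast,
    ← ENNReal.ofReal_mul hlam.le, ← ENNReal.ofReal_mul (by positivity),
    ENNReal.ofReal_le_ofReal_iff (by positivity), ← hd, mul_pow] at hle2
  have := le_of_mul_le_mul_right hle2 (by positivity)
  linarith

end

/-- Theorem 5.1(a): interior points are not mapped to boundary points. -/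
theorem interior_not_mapped_to_boundary (n : ℕ) (c : Euc n → Euc n → ℝ)
    (U V X : Set (Euc n)) (u : Euc n → ℝ) (lam : ℝ)
    (hB0 : B0cond n c U V) (hB1 : B1cond n c U V)
    (hu : CConvexOn n c (closure U) (closure V) u)
    (hlam : 0 < lam)
    (hX : X ⊆ closure U)
    (hge : MAge n c (closure U) (closure V) u lam X)
    (hVs : ∀ x ∈ X, StronglyConvexSet n (Vxset n c V x)) :
    (X ×ˢ frontier V) ∩ cSubdiff n c (closure U) (closure V) u
      ⊆ frontier X ×ˢ frontier V := by
  obtain ⟨hUo, hUb, hVo, hVb, hC⟩ := hB0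
  rintro ⟨xb, yb⟩ ⟨⟨hxX, hyF⟩, hsub⟩
  refine ⟨⟨subset_closure hxX, fun hXint => ?_⟩, hyF⟩
  dsimp only at hxX hyF hXint
  have hUc : IsCompact (closure U) := hUb.isCompact_closure
  have hVc : IsCompact (closure V) := hVb.isCompact_closure
  rw [hVo.frontier_eq] at hyF
  obtain ⟨hyT, hyV⟩ := hyF
  have hVne : V.Nonempty := closure_nonempty_iff.1 ⟨yb, hyT⟩
  obtain ⟨y0, hy0⟩ := hVne
  have hy0T : y0 ∈ closure V := subset_closure hy0
  obtain ⟨hconv, R, hR, htouch⟩ := hVs xb hxX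
  have hdiff := hB1.2 xb (hX hxX)
  have hinj := hdiff.1
  obtain ⟨T0, g, g', L, hT0f, hT0, hL, hT0cl, hg, hg', hgT, hgf, hTu, hTinv⟩ :=
    geom hVo hVb ⟨y0, hy0⟩ hdiff hconv
  have hmem : ∀ y ∈ closure V, -gradX n c xb y ∈ T0 := fun y hy => by
    rw [hT0f]; exact ⟨y, hy, rfl⟩
  have hfr : -gradX n c xb yb ∈ frontier (Vxset n c V xb) := by
    refine ⟨hT0cl (hmem yb hyT), fun h => ?_⟩
    obtain ⟨y, hy, hyy⟩ := interior_subset h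
    exact hyV (hinj (subset_closure hy) hyT hyy ▸ hy)
  obtain ⟨z, hz, hzball⟩ := htouch _ hfr
  have he : ∀ y ∈ closure V, inner ℝ (-gradX n c xb yb - z) (-gradX n c xb y - -gradX n c xb yb)
      ≤ -(1/2) * ‖-gradX n c xb y - -gradX n c xb yb‖ ^ 2 := by
    intro y hy
    have h1 : -gradX n c xb y ∈ closedBall z R :=
      closure_minimal hzball isClosed_closedBall (hT0cl (hmem y hy))
    rw [mem_closedBall, dist_eq_norm] at h1
    rw [dist_eq_norm] at hz
    have h2 := norm_add_sq_real (-gradX n c xb yb - z) (-gradX n c xb y - -gradX n c xb yb)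
    rw [show (-gradX n c xb yb - z) + (-gradX n c xb y - -gradX n c xb yb)
      = -gradX n c xb y - z by abel, hz] at h2
    have h3 : ‖-gradX n c xb y - z‖ ^ 2 ≤ R ^ 2 := pow_le_pow_left₀ (norm_nonneg _) h1 2
    linarith
  obtain ⟨P1, P2, hc, hP1, hP2, hP1c, hP2c, hP1d⟩ := derivs (W := interior X) (T := closure V)
    isOpen_interior hTu (hC.mono (prod_mono (interior_subset.trans hX) Subset.rfl))
  obtain ⟨r, hr, hrW, C, hC0, ε, hε, γ, hγ0, hγb, hdec, hlip⟩ :=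
    curve (P := fun x y => -gradX n c x y) isOpen_interior hVc hXint hyT hc hP1 hP2 hP1c hP2c
      (hP1d xb hXint yb hyT) (hTinv yb hyT _ (hP1 xb hXint yb hyT)) hT0 hL hT0f hg hg' hgT hgf he
  have hF := fenchel hUc hVc hC.continuousOn hu
  have hρ0 : 0 < ‖-gradX n c xb y0 - -gradX n c xb yb‖ := by
    rw [norm_pos_iff, sub_ne_zero]
    intro h
    exact hyV (hinj hy0T hyT h ▸ hy0)
  set τ : ℕ → ℝ := fun i => ε / 2 + ε / 2 * (1 / ((i : ℝ) + 1)) with hτ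
  have hτl : ∀ i, ε / 2 ≤ τ i := fun i => by
    have : 0 ≤ ε / 2 * (1 / ((i : ℝ) + 1)) := by positivity
    simp only [hτ]; linarith
  have hτu : ∀ i, τ i ≤ ε := fun i => by
    have h1 : 1 / ((i : ℝ) + 1) ≤ 1 := by
      rw [div_le_one (by positivity)]
      have : (0 : ℝ) ≤ i := i.cast_nonneg
      linarith
    have := mul_le_mul_of_nonneg_left h1 (by positivity : 0 ≤ ε / 2)
    simp only [hτ]; linarith
  have hτinj : Function.Injective τ := by
    intro i j hij
    simp only [hτ] at hij
    have h1 : ε / 2 * (1 / ((i : ℝ) + 1)) = ε / 2 * (1 / ((j : ℝ) + 1)) := by linarith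
    have h2 := mul_left_cancel₀ (by positivity : ε / 2 ≠ 0) h1
    rw [one_div, one_div, inv_inj] at h2
    exact_mod_cast (by linarith : (i : ℝ) = j)
  have hγlt : ∀ s t, 0 ≤ s → s < t → t ≤ ε → γ s ≠ γ t := by
    intro s t hs hst ht h
    have h1 := hdec y0 hy0T s t hs hst.le ht
    rw [h] at h1
    have h2 : 0 < (t - s) * ‖-gradX n c xb y0 - -gradX n c xb yb‖ ^ 2 :=
      mul_pos (sub_pos.2 hst) (pow_pos hρ0 2)
    linarith
  have hxinj : Function.Injective fun i => γ (τ i) := by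
    intro i j hij
    by_contra hne
    rcases lt_or_gt_of_ne (fun h => hne (hτinj h)) with h | h
    · exact hγlt _ _ (by linarith [hτl i]) h (hτu j) hij
    · exact hγlt _ _ (by linarith [hτl j]) h (hτu i) hij.symm
  refine vol_contra (D := 8 * C * L / ε) (r := r) (xb := xb) (yb := yb)
    (ν := cSubdiffImg n c (closure U) (closure V) u) (x := fun i => γ (τ i)) hlam
    (by positivity) hxinj (fun i => hγb _ ⟨by linarith [hτl i], hτu i⟩)
    (fun s hs hm => hge s (hs.trans (hrW.trans interior_subset)) hm) ?_
  intro δ hδ s hs hsd y hy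
  simp only [cSubdiffImg, mem_iUnion] at hy
  obtain ⟨x, hxs, hxA, hyB, hxy⟩ := hy
  dsimp only at hxA hyB hxy
  obtain ⟨-, -, hxyb⟩ := hsub
  dsimp only at hxyb
  obtain ⟨i, hi⟩ := hsd x hxs
  have hxr := hs hxs
  have hγi := hγb (τ i) ⟨by linarith [hτl i], hτu i⟩
  have f1 := hF xb (hX hxX) y hyB
  have f2 := hF x hxA yb hyT
  have f3 := hdec y hyB 0 (τ i) le_rfl (by linarith [hτl i]) (hτu i)
  have f4 := hlip y hyB (γ (τ i)) hγi x hxr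
  rw [hγ0] at f3
  have hmv := mv_param (Φ := fun y => y) (Φ' := fun _ => ContinuousLinearMap.id ℝ (Euc n))
    hT0 hg hg' hgT (fun y _ => hasFDerivWithinAt_id y _) zero_le_one (hmem y hyB) (hmem yb hyT)
    (fun _ _ _ => ContinuousLinearMap.norm_id_le)
  rw [hgf y hyB, hgf yb hyT] at hmv
  set ρ := ‖-gradX n c xb y - -gradX n c xb yb‖ with hρ
  have hρn : 0 ≤ ρ := norm_nonneg _
  rw [dist_eq_norm] at hi
  have f5 : C * ‖x - γ (τ i)‖ * ρ ≤ C * δ * ρ := by gcongr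
  have f6 : ε / 2 * ρ ^ 2 ≤ (τ i) * ρ ^ 2 := by gcongr; exact hτl i
  have f7 : ε / 8 * ρ ^ 2 ≤ C * δ * ρ := by nlinarith
  have f8 : ρ ≤ 8 * C * δ / ε := by
    rw [le_div_iff₀ hε]
    rcases hρn.eq_or_lt with h | h
    · rw [← h]; simp; positivity
    · have : ε / 8 * ρ ≤ C * δ := by
        refine le_of_mul_le_mul_right ?_ h
        linarith
      linarith
  rw [mem_closedBall, dist_eq_norm]
  calc ‖y - yb‖ ≤ 1 * L * ρ := hmv
    _ ≤ 1 * L * (8 * C * δ / ε) := by gcongr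
    _ = 8 * C * L / ε * δ := by ring
end

section
/- Let c satisfy (B0)–(B1), let u = u^{c*c} be c-convex, and let Λ > 0. If |∂ᶜu| ≤ Λ on cl U and U is strongly c-convex with respect to V (i.e. U_ȳ := −D_y c(U, ȳ) is strongly convex for every ȳ ∈ cl V), then boundary points of U cannot be mapped by ∂ᶜu into interior points of V: the set ∂U × V is disjoint from ∂ᶜu. -/
open Set MeasureTheory Metric Bornology
open scoped ENNReal NNReal Pointwise

section BNM

open Filter Topology

theorem bnm_lip_vol {n : ℕ} {K : ℝ≥0} {f : Euc n → Euc n} {s : Set (Euc n)}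
    (h : LipschitzOnWith K f s) : volume (f '' s) ≤ (K : ℝ≥0∞) ^ n * volume s := by
  have hH : (Measure.hausdorffMeasure (n : ℝ) : Measure (Euc n)).IsAddHaarMeasure := by
    simpa using MeasureTheory.isAddHaarMeasure_hausdorffMeasure (E := Euc n)
  have e := Measure.isAddLeftInvariant_eq_smul (volume : Measure (Euc n))
    (Measure.hausdorffMeasure (n : ℝ))
  have h1 := h.hausdorffMeasure_image_le (d := n) (by positivity)
  rw [ENNReal.rpow_natCast] at h1
  rw [e]
  simp only [Measure.smul_apply]
  rw [ENNReal.smul_def, ENNReal.smul_def, smul_eq_mul, smul_eq_mul]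
  calc _ ≤ _ := mul_le_mul_right h1 _
    _ = _ := by ring

theorem bnm_cconv {n : ℕ} {c : Euc n → Euc n → ℝ} {A B : Set (Euc n)} {u : Euc n → ℝ}
    (hA : IsCompact A) (hB : IsCompact B) (hAne : A.Nonempty) (hBne : B.Nonempty)
    (hc : ContinuousOn (Function.uncurry c) (A ×ˢ B)) (hu : CConvexOn n c A B u) :
    (∀ x ∈ A, ∀ y ∈ B, -c x y - u x ≤ cStarT n c A u y) ∧
    (∀ y ∈ B, ∃ x ∈ A, (x, y) ∈ cSubdiff n c A B u) := by
  obtain ⟨M, hM⟩ := (hA.prod hB).exists_bound_of_continuousOn hc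
  have hM' : ∀ x ∈ A, ∀ y ∈ B, |c x y| ≤ M := fun x hx y hy => hM (x, y) ⟨hx, hy⟩
  have hbelow : ∃ m, ∀ x ∈ A, m ≤ u x := by
    by_contra! hcon
    have hv : ∀ y ∈ B, cStarT n c A u y = 0 := by
      intro y hy
      apply Real.sSup_of_not_bddAbove
      rintro ⟨b, hb⟩
      obtain ⟨x, hx, hxm⟩ := hcon (-M - b)
      have : -c x y - u x ≤ b := hb (mem_image_of_mem _ hx)
      have h2 := abs_le.1 (hM' x hx y hy)
      linarith
    obtain ⟨x, hx, hxm⟩ := hcon (-M)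
    obtain ⟨y, hy⟩ := hBne
    have h1 := hu x hx
    have h2 : -c x y - cStarT n c A u y ≤ u x := by
      rw [h1]
      refine le_csSup ⟨M, ?_⟩ (mem_image_of_mem _ hy)
      rintro _ ⟨y', hy', rfl⟩
      have h2 := abs_le.1 (hM' x hx y' hy')
      simp only [hv y' hy']
      linarith
    have h3 := abs_le.1 (hM' x hx y hy)
    rw [hv y hy] at h2
    linarith
  obtain ⟨m, hm⟩ := hbelow
  have hbd : ∀ y ∈ B, BddAbove ((fun x => -c x y - u x) '' A) := by
    intro y hy
    refine ⟨M - m, ?_⟩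
    rintro _ ⟨x, hx, rfl⟩
    have h2 := abs_le.1 (hM' x hx y hy)
    have := hm x hx
    simp only
    linarith
  have h1 : ∀ x ∈ A, ∀ y ∈ B, -c x y - u x ≤ cStarT n c A u y := fun x hx y hy =>
    le_csSup (hbd y hy) (mem_image_of_mem (fun x => -c x y - u x) hx)
  refine ⟨h1, fun y hy => ?_⟩
  have hcy : ∀ y ∈ B, ContinuousOn (fun x => c x y) A := fun y hy =>
    hc.comp (f := fun x => (x, y)) (by fun_prop) (fun x hx => ⟨hx, hy⟩)
  have hlsc : LowerSemicontinuousOn u A := by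
    intro x0 hx0 a ha
    rw [hu x0 hx0] at ha
    obtain ⟨_, ⟨y', hy', rfl⟩, hlt⟩ := exists_lt_of_lt_csSup (hBne.image _) ha
    have hcont : ContinuousWithinAt (fun x => -c x y' - cStarT n c A u y') A x0 :=
      ((hcy y' hy').neg.sub continuousOn_const) x0 hx0
    filter_upwards [hcont.eventually (lt_mem_nhds hlt), self_mem_nhdsWithin] with x hx hxA
    have := h1 x hxA y' hy'
    linarith
  have hlsc2 : LowerSemicontinuousOn (fun x => c x y + u x) A :=
    (hcy y hy).lowerSemicontinuousOn.add hlsc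
  obtain ⟨x, hx, hmin⟩ := hlsc2.exists_isMinOn hAne hA
  refine ⟨x, hx, hx, hy, ?_⟩
  have : cStarT n c A u y = -c x y - u x := by
    apply IsGreatest.csSup_eq
    refine ⟨mem_image_of_mem (fun x => -c x y - u x) hx, ?_⟩
    rintro _ ⟨x', hx', rfl⟩
    have : c x y + u x ≤ c x' y + u x' := hmin hx'
    simp only
    linarith
  simp only [this]
  ring

theorem bnm_succ {E F : Type*} [NormedAddCommGroup E] [NormedSpace ℝ E] [NormedAddCommGroup F]
    [NormedSpace ℝ F] {g : E → F} {s : Set E} {a : E} {k : ℕ} (ha : a ∈ s)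
    (h : ContDiffWithinAt ℝ ((k + 1 : ℕ) : WithTop ℕ∞) g s a) :
    ∃ g' : E → E →L[ℝ] F, (∃ r > 0, ∀ z ∈ s ∩ ball a r, HasFDerivWithinAt g (g' z) s z) ∧
      ContDiffWithinAt ℝ (k : WithTop ℕ∞) g' s a := by
  rw [Nat.cast_add, Nat.cast_one, contDiffWithinAt_succ_iff_hasFDerivWithinAt' (by simp)] at h
  obtain ⟨w, hw, -, -, g', h1, h2⟩ := h
  rw [insert_eq_of_mem ha] at hw
  obtain ⟨r, hr, hr'⟩ := Metric.mem_nhdsWithin_iff.1 hw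
  exact ⟨g', ⟨r, hr, fun z hz => h1 z (hr' ⟨hz.2, hz.1⟩)⟩, h2⟩

theorem bnm_small {Z W : Type*} [TopologicalSpace Z] [NormedAddCommGroup W] {Φ : Z → W}
    {s : Set Z} {a : Z} (h : ContinuousWithinAt Φ s a) (h0 : Φ a = 0) {ε : ℝ} (hε : 0 < ε) :
    ∀ᶠ z in 𝓝[s] a, ‖Φ z‖ ≤ ε := by
  have h1 : ‖Φ a‖ < ε := by rw [h0, norm_zero]; exact hε
  exact (h.norm.eventually (gt_mem_nhds h1)).mono fun z hz => hz.le

theorem bnm_slice_x {E F G : Type*} [NormedAddCommGroup E] [NormedSpace ℝ E]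
    [NormedAddCommGroup F] [NormedSpace ℝ F] [NormedAddCommGroup G] [NormedSpace ℝ G]
    {g : E × F → G} {g' : E × F →L[ℝ] G} {A : Set E} {V : Set F} {x : E} {y : F} (hy : y ∈ V)
    (h : HasFDerivWithinAt g g' (A ×ˢ V) (x, y)) :
    HasFDerivWithinAt (fun x' => g (x', y)) (g'.comp (ContinuousLinearMap.inl ℝ E F)) A x :=
  HasFDerivWithinAt.comp (f := fun x' : E => (x', y)) x h
    (hasFDerivAt_prodMk_left x y).hasFDerivWithinAt (fun _ hx => ⟨hx, hy⟩)

theorem bnm_slice_y {E F G : Type*} [NormedAddCommGroup E] [NormedSpace ℝ E]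
    [NormedAddCommGroup F] [NormedSpace ℝ F] [NormedAddCommGroup G] [NormedSpace ℝ G]
    {g : E × F → G} {g' : E × F →L[ℝ] G} {A : Set E} {V : Set F} (hV : IsOpen V)
    {x : E} {y : F} (hx : x ∈ A) (hy : y ∈ V)
    (h : HasFDerivWithinAt g g' (A ×ˢ V) (x, y)) :
    HasFDerivAt (fun y' => g (x, y')) (g'.comp (ContinuousLinearMap.inr ℝ E F)) y :=
  (HasFDerivWithinAt.comp (f := fun y' : F => (x, y')) y h
    (hasFDerivAt_prodMk_right x y).hasFDerivWithinAt (fun _ hy => ⟨hx, hy⟩)).hasFDerivAt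
    (hV.mem_nhds hy)

theorem bnm_core {E G : Type*} [NormedAddCommGroup E] [NormedSpace ℝ E]
    [NormedAddCommGroup G] [NormedSpace ℝ G] {A V : Set E} {F : E × E → G}
    {Fx : E × E → E →L[ℝ] G} {N : E → G →L[ℝ] G} {X : E → E} {M : E → E →L[ℝ] E} {Q : Set E}
    {xh yh qh : E} (hxh : xh ∈ A) (hyh : yh ∈ V)
    (hF : ∃ r > 0, ∀ z ∈ (A ×ˢ V) ∩ ball (xh, yh) r,
      HasFDerivWithinAt (fun x => F (x, z.2)) (Fx z) A z.1)
    (hFx : ContDiffWithinAt ℝ ((0 + 1 : ℕ) : WithTop ℕ∞) Fx (A ×ˢ V) (xh, yh))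
    (hN : ContinuousAt N yh) (hN1 : N yh = ContinuousLinearMap.id ℝ G)
    (hN2 : ∀ y, (N y).comp (Fx (xh, yh)) = Fx (xh, y))
    (hQ : Convex ℝ Q) (hqh : qh ∈ Q) (hXq : X qh = xh) (hXm : MapsTo X Q A)
    (hX : ∃ r > 0, ∀ q ∈ Q ∩ ball qh r, HasFDerivWithinAt X (M q) Q q)
    (hM : ContinuousWithinAt M Q qh) :
    ∀ ω > 0, ∃ r > 0, ∀ q ∈ Q ∩ ball qh r, ∀ y ∈ V ∩ ball yh r,
      ‖F (X q, y) - F (xh, y) - N y (F (X q, yh) - F (xh, yh))‖ ≤ ω * ‖q - qh‖ ^ 2 := by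
  intro ω hω
  obtain ⟨r1, hr1, hF⟩ := hF
  obtain ⟨F2, ⟨r2, hr2, hF2⟩, hF2c⟩ := bnm_succ (s := A ×ˢ V) (a := (xh, yh)) (mk_mem_prod hxh hyh) hFx
  obtain ⟨r3, hr3, hX⟩ := hX
  set K : ℝ := ‖M qh‖ + 1 with hK
  have hKpos : 0 < K := by positivity
  set ε : ℝ := ω / K ^ 2 with hε
  have hεpos : 0 < ε := by positivity
  have hMK : ∀ᶠ q in 𝓝[Q] qh, ‖M q‖ ≤ K := by
    have := hM.norm.eventually (gt_mem_nhds (show ‖M qh‖ < K by simp [hK]))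
    exact this.mono fun q hq => hq.le
  set Fxx : E × E → E →L[ℝ] E →L[ℝ] G := fun z => (F2 z).comp (ContinuousLinearMap.inl ℝ E E)
    with hFxx
  have hFxxc : ContinuousWithinAt Fxx (A ×ˢ V) (xh, yh) :=
    hF2c.continuousWithinAt.clm_comp continuousWithinAt_const
  have hΦ : ContinuousWithinAt (fun z : E × E => Fxx z -
      (ContinuousLinearMap.compL ℝ E G G (N z.2)).comp (Fxx (z.1, yh))) (A ×ˢ V) (xh, yh) := by
    refine hFxxc.sub (ContinuousWithinAt.clm_comp ?_ ?_)
    · refine (ContinuousLinearMap.continuous _).continuousAt.comp_continuousWithinAt ?_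
      exact (hN.comp_of_eq continuousAt_snd rfl).continuousWithinAt
    · refine ContinuousWithinAt.comp (t := A ×ˢ V) (x := (xh, yh)) (g := Fxx)
        (f := fun z : E × E => (z.1, yh)) hFxxc ?_ ?_
      · exact (Continuous.continuousWithinAt (by fun_prop))
      · exact fun z hz => ⟨hz.1, hyh⟩
  have hΦs : ∀ᶠ z in 𝓝[A ×ˢ V] (xh, yh), ‖Fxx z -
      (ContinuousLinearMap.compL ℝ E G G (N z.2)).comp (Fxx (z.1, yh))‖ ≤ ε := by
    have h0 : Fxx (xh, yh) -
        (ContinuousLinearMap.compL ℝ E G G (N yh)).comp (Fxx (xh, yh)) = 0 := by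
      rw [hN1]; ext; simp
    exact bnm_small (W := E →L[ℝ] E →L[ℝ] G) hΦ h0 hεpos
  obtain ⟨r4, hr4, hΦs⟩ := Metric.mem_nhdsWithin_iff.1 hΦs
  obtain ⟨r5, hr5, hMK⟩ := Metric.mem_nhdsWithin_iff.1 hMK
  set r0 := min r1 (min r2 r4) with hr0
  have hr0pos : 0 < r0 := by positivity
  have hXc : ContinuousWithinAt X Q qh :=
    (hX qh ⟨hqh, mem_ball_self hr3⟩).continuousWithinAt
  have hXev : ∀ᶠ q in 𝓝[Q] qh, X q ∈ ball xh r0 := by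
    apply hXc.eventually
    rw [hXq]; exact ball_mem_nhds _ hr0pos
  obtain ⟨r6, hr6, hXev⟩ := Metric.mem_nhdsWithin_iff.1 hXev
  set r := min r0 (min r3 (min r5 r6)) with hr
  have hrpos : 0 < r := by positivity
  have hrr0 : r ≤ r0 := min_le_left _ _
  have hrr3 : r ≤ r3 := (min_le_right _ _).trans (min_le_left _ _)
  have hrr5 : r ≤ r5 := (min_le_right _ _).trans ((min_le_right _ _).trans (min_le_left _ _))
  have hrr6 : r ≤ r6 := (min_le_right _ _).trans ((min_le_right _ _).trans (min_le_right _ _))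
  have hr01 : r0 ≤ r1 := min_le_left _ _
  have hr02 : r0 ≤ r2 := (min_le_right _ _).trans (min_le_left _ _)
  have hr04 : r0 ≤ r4 := (min_le_right _ _).trans (min_le_right _ _)
  refine ⟨r, hrpos, fun q hq y hy => ?_⟩
  set S := Q ∩ ball qh r with hS
  have hSconv : Convex ℝ S := hQ.inter (convex_ball _ _)
  have hXd : ∀ q ∈ S, HasFDerivWithinAt X (M q) S q := fun q hq =>
    (hX q ⟨hq.1, ball_subset_ball hrr3 hq.2⟩).mono inter_subset_left
  have hMb : ∀ q ∈ S, ‖M q‖ ≤ K := fun q hq => hMK ⟨ball_subset_ball hrr5 hq.2, hq.1⟩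
  have hXb : ∀ q ∈ S, X q ∈ ball xh r0 := fun q hq => hXev ⟨ball_subset_ball hrr6 hq.2, hq.1⟩
  have hXA : ∀ q ∈ S, X q ∈ A := fun q hq => hXm hq.1
  have hSm : MapsTo X S A := fun q hq => hXA q hq
  have hpt : ∀ q ∈ S, ∀ y ∈ V ∩ ball yh r, ∀ ρ, r0 ≤ ρ →
      ((X q, y) : E × E) ∈ (A ×ˢ V) ∩ ball (xh, yh) ρ := by
    intro q hq y hy ρ hρ
    refine ⟨⟨hXA q hq, hy.1⟩, ?_⟩
    rw [← ball_prod_same]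
    exact ⟨ball_subset_ball hρ (hXb q hq), ball_subset_ball (hrr0.trans hρ) hy.2⟩
  have hyh' : yh ∈ V ∩ ball yh r := ⟨hyh, mem_ball_self hrpos⟩
  have hqh' : qh ∈ S := ⟨hqh, mem_ball_self hrpos⟩
  set B : E → E →L[ℝ] G := fun q => Fx (X q, y) - (N y).comp (Fx (X q, yh)) with hB
  have hBd : ∀ q ∈ S, HasFDerivWithinAt B ((Fxx (X q, y) -
      (ContinuousLinearMap.compL ℝ E G G (N y)).comp (Fxx (X q, yh))).comp (M q)) S q := by
    intro q hq
    have h1 : ∀ y ∈ V ∩ ball yh r, HasFDerivWithinAt (fun q => Fx (X q, y))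
        ((Fxx (X q, y)).comp (M q)) S q := fun y hy =>
      HasFDerivWithinAt.comp (g := fun x => Fx (x, y)) (f := X) q
        (bnm_slice_x hy.1 (hF2 _ (hpt q hq y hy r2 hr02))) (hXd q hq) hSm
    have h2 := (h1 y hy).sub
      ((ContinuousLinearMap.compL ℝ E G G (N y)).hasFDerivAt.comp_hasFDerivWithinAt q (h1 yh hyh'))
    convert! h2 using 1
  have hB0 : B qh = 0 := by
    simp only [hB, hXq, hN2, sub_self]
  have hBle : ∀ q ∈ S, ‖B q‖ ≤ ε * K * ‖q - qh‖ := by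
    intro q hq
    have := Convex.norm_image_sub_le_of_norm_hasFDerivWithin_le (C := ε * K) hBd ?_ hSconv hqh' hq
    · simpa [hB0] using this
    · intro q' hq'
      refine (ContinuousLinearMap.opNorm_comp_le _ _).trans ?_
      have hz := hpt q' hq' y hy r4 hr04
      have := hΦs ⟨hz.2, hz.1⟩
      exact mul_le_mul this (hMb q' hq') (norm_nonneg _) hεpos.le
  set Ψ : E → G := fun q => F (X q, y) - N y (F (X q, yh)) with hΨ
  have hΨd : ∀ q ∈ S, HasFDerivWithinAt Ψ ((B q).comp (M q)) S q := by
    intro q hq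
    have h1 : ∀ y ∈ V ∩ ball yh r, HasFDerivWithinAt (fun q => F (X q, y))
        ((Fx (X q, y)).comp (M q)) S q := fun y hy =>
      HasFDerivWithinAt.comp (g := fun x => F (x, y)) (f := X) q
        (hF _ (hpt q hq y hy r1 hr01)) (hXd q hq) hSm
    have h2 := (h1 y hy).sub ((N y).hasFDerivAt.comp_hasFDerivWithinAt q (h1 yh hyh'))
    convert! h2 using 1
  set T := S ∩ closedBall qh ‖q - qh‖ with hT
  have hTconv : Convex ℝ T := hSconv.inter (convex_closedBall _ _)
  have hfin := Convex.norm_image_sub_le_of_norm_hasFDerivWithin_le (s := T) (f := Ψ)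
    (f' := fun q => (B q).comp (M q)) (C := ε * K * ‖q - qh‖ * K) (x := qh) (y := q)
    (fun q' hq' => (hΨd q' hq'.1).mono inter_subset_left) ?_ hTconv
    ⟨hqh', by simp⟩ ⟨hq, by simp [dist_eq_norm]⟩
  · have e1 : F (X q, y) - F (xh, y) - N y (F (X q, yh) - F (xh, yh)) = Ψ q - Ψ qh := by
      simp only [hΨ, hXq, map_sub]; abel
    rw [e1]
    refine hfin.trans (le_of_eq ?_)
    rw [hε]; field_simp
  · intro q' hq'
    refine (ContinuousLinearMap.opNorm_comp_le _ _).trans ?_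
    have h1 := hBle q' hq'.1
    have h2 : ‖q' - qh‖ ≤ ‖q - qh‖ := by simpa [dist_eq_norm] using hq'.2
    have h3 : ‖B q'‖ ≤ ε * K * ‖q - qh‖ := h1.trans (by gcongr)
    exact mul_le_mul h3 (hMb q' hq'.1) (norm_nonneg _) (by positivity)

/-- The Riesz map as a real linear map. -/
noncomputable def bnmJ (n : ℕ) : (Euc n →L[ℝ] ℝ) →L[ℝ] Euc n :=
  LinearMap.mkContinuous
    { toFun := fun l => (InnerProductSpace.toDual ℝ (Euc n)).symm l
      map_add' := fun a b => by simp
      map_smul' := fun r a => by simp } 1 (fun l => by simp)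

theorem bnmJ_inner {n : ℕ} (l : Euc n →L[ℝ] ℝ) (v : Euc n) : inner ℝ (bnmJ n l) v = l v :=
  InnerProductSpace.toDual_symm_apply

theorem bnmJ_gradY {n : ℕ} (c : Euc n → Euc n → ℝ) (x y : Euc n) :
    gradY n c x y = bnmJ n (fderiv ℝ (fun y' => c x y') y) := rfl

theorem bnmJ_inj {n : ℕ} : Function.Injective (bnmJ n) :=
  (InnerProductSpace.toDual ℝ (Euc n)).symm.injective

set_option maxHeartbeats 4000000 in
theorem bnm_expand {n : ℕ} {c : Euc n → Euc n → ℝ} {U V : Set (Euc n)} {xh yh : Euc n}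
    (hU : IsOpen U) (hUb : IsBounded U) (hV : IsOpen V) (hxh : xh ∈ closure U) (hyh : yh ∈ V)
    (hc : ContDiffOn ℝ 4 (Function.uncurry c) (closure U ×ˢ closure V))
    {f : Euc n → Euc n} (hf : f = fun x => -gradY n c x yh)
    (hD : DiffeoOnto n f (closure U)) (hconv : Convex ℝ (f '' closure U)) :
    ∃ p : Euc n → Euc n, HasStrictFDerivAt p (ContinuousLinearMap.id ℝ (Euc n)) yh ∧ p yh = 0 ∧
      ∀ ω > 0, ∃ ρ > 0, ball yh ρ ⊆ V ∧ ∀ y ∈ ball yh ρ, ∀ x ∈ closure U,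
        |(-(c x y - c xh y) + (c x yh - c xh yh)) - inner ℝ (f x - f xh) (p y)|
          ≤ ω * ‖f x - f xh‖ ^ 2 * ‖y - yh‖ := by
  set A := closure U with hA
  have hAc : IsCompact A := hUb.isCompact_closure
  set s := A ×ˢ V with hs
  set J := bnmJ n with hJ
  have hc' : ∀ a ∈ s, ContDiffWithinAt ℝ ((3 + 1 : ℕ) : WithTop ℕ∞) (Function.uncurry c) s a :=
    fun a ha => by
      have := (hc a ⟨ha.1, subset_closure ha.2⟩).mono (prod_mono_right subset_closure)
      exact_mod_cast this
  set H : Euc n × Euc n → Euc n →L[ℝ] ℝ := fun z => fderiv ℝ (fun y' => c z.1 y') z.2 with hH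
  set P : (Euc n × Euc n →L[ℝ] ℝ) →L[ℝ] (Euc n →L[ℝ] ℝ) :=
    (ContinuousLinearMap.compL ℝ (Euc n) (Euc n × Euc n) ℝ).flip
      (ContinuousLinearMap.inr ℝ (Euc n) (Euc n)) with hP
  have hslice : ∀ z ∈ s, ∀ c1 : Euc n × Euc n →L[ℝ] ℝ,
      HasFDerivWithinAt (Function.uncurry c) c1 s z → HasFDerivAt (c z.1) (P c1) z.2 :=
    fun z hz c1 h => bnm_slice_y (g := Function.uncurry c) hV hz.1 hz.2 h
  have hHeq : ∀ z ∈ s, ∀ c1 : Euc n × Euc n →L[ℝ] ℝ,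
      HasFDerivWithinAt (Function.uncurry c) c1 s z → H z = P c1 :=
    fun z hz c1 h => (hslice z hz c1 h).fderiv
  have hHd : ∀ z ∈ s, HasFDerivAt (c z.1) (H z) z.2 := by
    intro z hz
    obtain ⟨c1, ⟨r, hr, h1⟩, -⟩ := bnm_succ hz (hc' z hz)
    have h2 := h1 z ⟨hz, mem_ball_self hr⟩
    rw [hHeq z hz _ h2]
    exact hslice z hz _ h2
  have hHc : ContinuousOn H s := by
    intro z hz
    obtain ⟨c1, ⟨r, hr, h1⟩, h2⟩ := bnm_succ hz (hc' z hz)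
    have h3 : ContinuousWithinAt (fun z => P (c1 z)) s z :=
      P.continuous.continuousAt.comp_continuousWithinAt h2.continuousWithinAt
    refine h3.congr_of_eventuallyEq ?_ (hHeq z hz _ (h1 z ⟨hz, mem_ball_self hr⟩))
    filter_upwards [self_mem_nhdsWithin, mem_nhdsWithin_of_mem_nhds (ball_mem_nhds z hr)]
      with w hw hw2
    exact hHeq w hw _ (h1 w ⟨hw, hw2⟩)
  have ha : ((xh, yh) : Euc n × Euc n) ∈ s := ⟨hxh, hyh⟩
  obtain ⟨c1, hc1e, hc1⟩ := bnm_succ ha (hc' _ ha)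
  obtain ⟨c2, hc2e, hc2⟩ := bnm_succ (k := 2) ha hc1
  obtain ⟨c3, hc3e, -⟩ := bnm_succ (k := 1) ha hc2
  obtain ⟨r0, hr0, hr0V, hc1d, hc2d, hc2c⟩ : ∃ r0 > 0, ball yh r0 ⊆ V ∧
      (∀ z ∈ s ∩ ball (xh, yh) r0, HasFDerivWithinAt (Function.uncurry c) (c1 z) s z) ∧
      (∀ z ∈ s ∩ ball (xh, yh) r0, HasFDerivWithinAt c1 (c2 z) s z) ∧
      (∀ z ∈ s ∩ ball (xh, yh) r0, ContinuousWithinAt c2 s z) := by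
    obtain ⟨r1, hr1, h1⟩ := hc1e
    obtain ⟨r2, hr2, h2⟩ := hc2e
    obtain ⟨r3, hr3, h3⟩ := hc3e
    obtain ⟨r4, hr4, h4⟩ := Metric.isOpen_iff.1 hV yh hyh
    refine ⟨min (min r1 r2) (min r3 r4), by positivity, ?_, ?_, ?_, ?_⟩
    · exact (ball_subset_ball ((min_le_right _ _).trans (min_le_right _ _))).trans h4
    · exact fun z hz => h1 z ⟨hz.1, ball_subset_ball
        ((min_le_left _ _).trans (min_le_left _ _)) hz.2⟩
    · exact fun z hz => h2 z ⟨hz.1, ball_subset_ball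
        ((min_le_left _ _).trans (min_le_right _ _)) hz.2⟩
    · exact fun z hz => (h3 z ⟨hz.1, ball_subset_ball
        ((min_le_right _ _).trans (min_le_left _ _)) hz.2⟩).continuousWithinAt
  clear hc1e hc2e hc3e
  have hmem : ∀ x ∈ A, ∀ y, dist x xh < r0 → dist y yh < r0 →
      ((x, y) : Euc n × Euc n) ∈ s ∩ ball (xh, yh) r0 := by
    intro x hx y h1 h2
    refine ⟨⟨hx, hr0V h2⟩, ?_⟩
    rw [← ball_prod_same]
    exact ⟨h1, h2⟩
  have hmemy : ∀ y ∈ ball yh r0, ((xh, y) : Euc n × Euc n) ∈ s ∩ ball (xh, yh) r0 :=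
    fun y hy => hmem xh hxh y (by simpa using hr0) hy
  set F : Euc n × Euc n → Euc n →L[ℝ] ℝ := fun z => P (c1 z) with hF
  have hFH : ∀ z ∈ s ∩ ball (xh, yh) r0, H z = F z := fun z hz =>
    hHeq z hz.1 _ (hc1d z hz)
  set Fx : Euc n × Euc n → Euc n →L[ℝ] Euc n →L[ℝ] ℝ := fun z =>
    P.comp ((c2 z).comp (ContinuousLinearMap.inl ℝ (Euc n) (Euc n))) with hFx
  have hFxd : ∀ z ∈ s ∩ ball (xh, yh) r0,
      HasFDerivWithinAt (fun x => F (x, z.2)) (Fx z) A z.1 := fun z hz =>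
    P.hasFDerivAt.comp_hasFDerivWithinAt z.1 (bnm_slice_x hz.1.2 (hc2d z hz))
  have hFx1 : ContDiffWithinAt ℝ ((0 + 1 : ℕ) : WithTop ℕ∞) Fx s (xh, yh) :=
    contDiffWithinAt_const.clm_comp
      ((hc2.of_le (by norm_num)).clm_comp contDiffWithinAt_const)
  have hFxc : ∀ z ∈ s ∩ ball (xh, yh) r0, ContinuousWithinAt Fx s z := fun z hz =>
    continuousWithinAt_const.clm_comp ((hc2c z hz).clm_comp continuousWithinAt_const)
  have hfH : ∀ x, f x = -J (H (x, yh)) := fun x => by rw [hf]; rfl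
  have hfc : ContinuousOn f A := by
    have : ContinuousOn (fun x => -J (H (x, yh))) A :=
      (J.continuous.comp_continuousOn
        (hHc.comp (f := fun x => (x, yh)) (by fun_prop) (fun x hx => ⟨hx, hyh⟩))).neg
    exact this.congr fun x _ => hfH x
  set Q := f '' A with hQ
  set X := Function.invFunOn f A with hX
  have hXf : ∀ x ∈ A, X (f x) = x := fun x hx => hD.1.leftInvOn_invFunOn hx
  have hXm : MapsTo X Q A := fun q hq => Function.invFunOn_mem hq
  have hqh : f xh ∈ Q := mem_image_of_mem _ hxh
  obtain ⟨M, hMd, hMc⟩ := bnm_succ (k := 0) hqh (by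
    have := hD.2.2 (f xh) hqh
    exact_mod_cast this)
  have hMc : ContinuousWithinAt M Q (f xh) := hMc.continuousWithinAt
  set M0 := M (f xh) with hM0
  set L : Euc n →L[ℝ] Euc n := -(J.comp (Fx (xh, yh))) with hL
  have hclU : (𝓝[U] xh).NeBot := mem_closure_iff_nhdsWithin_neBot.1 hxh
  have hUA : U ⊆ A := subset_closure
  have hML : M0.comp L = ContinuousLinearMap.id ℝ (Euc n) := by
    obtain ⟨rM, hrM, hMd'⟩ := hMd
    have hev : ∀ᶠ x in 𝓝[U] xh, (M (f x)).comp (-(J.comp (Fx (x, yh)))) =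
        ContinuousLinearMap.id ℝ (Euc n) := by
      have hfball : ∀ᶠ x in 𝓝[U] xh, f x ∈ ball (f xh) rM :=
        ((hfc xh hxh).mono hUA).eventually (ball_mem_nhds _ hrM)
      filter_upwards [self_mem_nhdsWithin, mem_nhdsWithin_of_mem_nhds (ball_mem_nhds xh hr0),
        hfball] with x hxU hxb hxf
      have h1 : HasFDerivAt f (-(J.comp (Fx (x, yh)))) x := by
        have h2 := (J.hasFDerivAt.comp_hasFDerivWithinAt x
          (hFxd (x, yh) (hmem x (hUA hxU) yh hxb (by simpa using hr0)))).neg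
        have h3 := (h2.mono hUA).hasFDerivAt (hU.mem_nhds hxU)
        refine h3.congr_of_eventuallyEq ?_
        filter_upwards [hU.mem_nhds hxU, isOpen_ball.mem_nhds hxb] with x' hx' hxb'
        rw [hfH, hFH _ (hmem x' (hUA hx') yh hxb' (by simpa using hr0))]
        rfl
      have h4 := (hMd' (f x) ⟨mem_image_of_mem _ (hUA hxU), hxf⟩).comp x
        (h1.hasFDerivWithinAt (s := U)) (fun x' hx' => mem_image_of_mem _ (hUA hx'))
      have h5 := h4.hasFDerivAt (hU.mem_nhds hxU)
      have h6 : HasFDerivAt (X ∘ f) (ContinuousLinearMap.id ℝ (Euc n)) x :=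
        (hasFDerivAt_id x).congr_of_eventuallyEq (by
          filter_upwards [hU.mem_nhds hxU] with x' hx'
          exact hXf x' (hUA hx'))
      exact h5.unique h6
    have hl1 : ContinuousWithinAt (fun x => M (f x)) U xh :=
      hMc.comp ((hfc xh hxh).mono hUA) (fun x hx => mem_image_of_mem _ (hUA hx))
    have hl2 : ContinuousWithinAt (fun x => Fx (x, yh)) U xh :=
      (hFxc (xh, yh) (hmemy yh (mem_ball_self hr0))).comp (f := fun x => (x, yh)) (x := xh)
        (Continuous.continuousWithinAt (by fun_prop)) (fun x hx => ⟨hUA hx, hyh⟩)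
    have hl3 : ContinuousWithinAt (fun x => (M (f x)).comp (-(J.comp (Fx (x, yh))))) U xh :=
      hl1.clm_comp (continuousWithinAt_const.clm_comp hl2).neg
    exact tendsto_nhds_unique_of_eventuallyEq hl3 tendsto_const_nhds hev
  have hLM : L.comp M0 = ContinuousLinearMap.id ℝ (Euc n) := by
    have h1 : (M0 : Euc n →ₗ[ℝ] Euc n) * (L : Euc n →ₗ[ℝ] Euc n) = 1 := by
      ext1 v
      exact congrArg (fun g : Euc n →L[ℝ] Euc n => g v) hML
    have h2 := mul_eq_one_comm.1 h1
    ext1 v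
    exact congrArg (fun g : Euc n →ₗ[ℝ] Euc n => g v) h2
  have hsymm : ∀ y ∈ ball yh r0, ∀ v w, c2 (xh, y) v w = c2 (xh, y) w v := by
    intro y hy v w
    have hev : ∀ᶠ x in 𝓝[U] xh, c2 (x, y) v w = c2 (x, y) w v := by
      filter_upwards [self_mem_nhdsWithin, mem_nhdsWithin_of_mem_nhds (ball_mem_nhds xh hr0)]
        with x hxU hxb
      have hopen : ∀ᶠ z in 𝓝 ((x, y) : Euc n × Euc n), z ∈ s ∩ ball (xh, yh) r0 ∧ s ∈ 𝓝 z := by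
        have ho : (U ×ˢ V) ∩ ball (xh, yh) r0 ∈ 𝓝 ((x, y) : Euc n × Euc n) :=
          ((hU.prod hV).inter isOpen_ball).mem_nhds
            ⟨⟨hxU, hr0V hy⟩, (hmem x (hUA hxU) y hxb hy).2⟩
        filter_upwards [ho] with z hz
        refine ⟨⟨⟨hUA hz.1.1, hz.1.2⟩, hz.2⟩, ?_⟩
        exact mem_of_superset ((hU.prod hV).mem_nhds hz.1) (prod_mono_left hUA)
      refine second_derivative_symmetric_of_eventually (𝕜 := ℝ) (f := Function.uncurry c)
        (f' := c1) (x := (x, y)) ?_ ?_ v w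
      · filter_upwards [hopen] with z hz using (hc1d z hz.1).hasFDerivAt hz.2
      · have hz := hopen.self_of_nhds
        exact (hc2d _ hz.1).hasFDerivAt hz.2
    have hl : ContinuousWithinAt (fun x => c2 (x, y)) U xh :=
      (hc2c (xh, y) (hmemy y hy)).comp (f := fun x => (x, y)) (x := xh)
        (Continuous.continuousWithinAt (by fun_prop)) (fun x hx => ⟨hUA hx, hr0V hy⟩)
    have hl1 : ∀ v w, ContinuousWithinAt (fun x => c2 (x, y) v w) U xh := fun v w =>
      (hl.clm_apply continuousWithinAt_const).clm_apply continuousWithinAt_const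
    exact tendsto_nhds_unique_of_eventuallyEq (hl1 v w) (hl1 w v) hev
  set N : Euc n → (Euc n →L[ℝ] ℝ) →L[ℝ] (Euc n →L[ℝ] ℝ) := fun y =>
    (Fx (xh, y)).comp (M0.comp (-J)) with hN
  have hNc : ContinuousAt N yh := by
    have h1 : ContinuousWithinAt (fun y => Fx (xh, y)) V yh :=
      (hFxc (xh, yh) (hmemy yh (mem_ball_self hr0))).comp (f := fun y => (xh, y)) (x := yh)
        (Continuous.continuousWithinAt (by fun_prop)) (fun y hy => ⟨hxh, hy⟩)
    exact (h1.continuousAt (hV.mem_nhds hyh)).clm_comp continuousAt_const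
  have hN1 : N yh = ContinuousLinearMap.id ℝ _ := by
    ext1 l
    apply bnmJ_inj
    have h1 := congrArg (fun g : Euc n →L[ℝ] Euc n => g (-(J l))) hLM
    simp only [hL, ContinuousLinearMap.comp_apply, ContinuousLinearMap.neg_apply,
      ContinuousLinearMap.id_apply] at h1
    simp only [hN, ContinuousLinearMap.comp_apply, ContinuousLinearMap.neg_apply,
      ContinuousLinearMap.id_apply]
    exact neg_injective h1
  have hN2 : ∀ y, (N y).comp (Fx (xh, yh)) = Fx (xh, y) := by
    intro y
    ext1 v
    have h1 := congrArg (fun g : Euc n →L[ℝ] Euc n => g v) hML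
    simp only [hL, ContinuousLinearMap.comp_apply, ContinuousLinearMap.neg_apply,
      ContinuousLinearMap.id_apply] at h1
    simp only [hN, ContinuousLinearMap.comp_apply, ContinuousLinearMap.neg_apply]
    rw [h1]
  have hcore := bnm_core (A := A) (V := V) (F := F) (Fx := Fx) (N := N) (X := X) (M := M) (Q := Q)
    hxh hyh ⟨r0, hr0, hFxd⟩ hFx1 hNc hN1 hN2 hconv hqh (hXf xh hxh) hXm hMd hMc
  set T : (Euc n × Euc n →L[ℝ] ℝ) →L[ℝ] (Euc n →L[ℝ] ℝ) :=
    (ContinuousLinearMap.compL ℝ (Euc n) (Euc n × Euc n) ℝ).flip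
      ((ContinuousLinearMap.inl ℝ (Euc n) (Euc n)).comp M0) with hT
  set p : Euc n → Euc n := fun y => -(J (T (c1 (xh, y) - c1 (xh, yh)))) with hp
  set p' : Euc n → Euc n →L[ℝ] Euc n := fun y =>
    -((J.comp T).comp ((c2 (xh, y)).comp (ContinuousLinearMap.inr ℝ (Euc n) (Euc n)))) with hp'
  have hpd : ∀ y ∈ ball yh r0, HasFDerivAt p (p' y) y := by
    intro y hy
    have h1 := bnm_slice_y hV hxh (hr0V hy) (hc2d (xh, y) (hmemy y hy))
    have h2 := ((J.comp T).hasFDerivAt.comp y (h1.sub_const (c1 (xh, yh)))).neg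
    exact h2
  have hp'inner : ∀ y ∈ ball yh r0, ∀ q η, inner ℝ q (p' y η) = -(Fx (xh, y) (M0 q) η) := by
    intro y hy q η
    rw [real_inner_comm]
    have h1 : inner ℝ (p' y η) q = -(c2 (xh, y) (0, η) (M0 q, 0)) := by
      simp only [hp', ContinuousLinearMap.neg_apply, ContinuousLinearMap.comp_apply, inner_neg_left]
      rw [hJ, bnmJ_inner]
      simp [hT]
    rw [h1, hsymm y hy]
    simp [hFx, hP]
  have hp1 : p' yh = ContinuousLinearMap.id ℝ (Euc n) := by
    ext1 η
    refine ext_inner_left ℝ fun q => ?_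
    rw [hp'inner yh (mem_ball_self hr0)]
    have h1 := congrArg (fun g : Euc n →L[ℝ] Euc n => inner ℝ (g q) η) hLM
    simp only [hL, ContinuousLinearMap.comp_apply, ContinuousLinearMap.neg_apply,
      ContinuousLinearMap.id_apply, inner_neg_left] at h1
    rw [hJ, bnmJ_inner] at h1
    exact h1
  have hp'c : ContinuousAt p' yh := by
    have h1 : ContinuousWithinAt (fun y => c2 (xh, y)) V yh :=
      (hc2c (xh, yh) (hmemy yh (mem_ball_self hr0))).comp (f := fun y => (xh, y)) (x := yh)
        (Continuous.continuousWithinAt (by fun_prop)) (fun y hy => ⟨hxh, hy⟩)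
    exact (continuousAt_const.clm_comp
      ((h1.continuousAt (hV.mem_nhds hyh)).clm_comp continuousAt_const)).neg
  refine ⟨p, ?_, by simp [hp], ?_⟩
  · rw [← hp1]
    refine hasStrictFDerivAt_of_hasFDerivAt_of_continuousAt ?_ hp'c
    filter_upwards [ball_mem_nhds yh hr0] with y hy using hpd y hy
  intro ω hω
  have hloc : ∀ x0 ∈ A, ∀ᶠ z : Euc n × Euc n in 𝓝 (yh, x0), z.2 ∈ A →
      ‖H (z.2, z.1) - H (xh, z.1) - N z.1 (H (z.2, yh) - H (xh, yh))‖
        ≤ ω * ‖f z.2 - f xh‖ ^ 2 := by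
    intro x0 hx0
    by_cases hx : x0 = xh
    · obtain ⟨r, hr, hest⟩ := hcore ω hω
      rw [hx, nhds_prod_eq]
      have hfball : ∀ᶠ x in 𝓝 xh, x ∈ A → f x ∈ ball (f xh) r :=
        eventually_nhdsWithin_iff.1 ((hfc xh hxh).eventually (ball_mem_nhds _ hr))
      have e1 : ∀ᶠ y in 𝓝 yh, y ∈ ball yh r0 ∧ y ∈ ball yh r :=
        inter_mem (ball_mem_nhds yh hr0) (ball_mem_nhds yh hr)
      have e2 := hfball.and (ball_mem_nhds xh hr0)
      filter_upwards [e1.prod_mk e2] with z hz hzA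
      obtain ⟨⟨hy0, hyr⟩, hfz, hxb⟩ := hz
      have h1 := hest (f z.2) ⟨mem_image_of_mem _ hzA, hfz hzA⟩ z.1 ⟨hr0V hy0, hyr⟩
      rw [hXf z.2 hzA] at h1
      rw [hFH _ (hmem z.2 hzA z.1 hxb hy0), hFH _ (hmemy z.1 hy0),
        hFH _ (hmem z.2 hzA yh hxb (by simpa using hr0)), hFH _ (hmemy yh (mem_ball_self hr0))]
      exact h1
    · have hne : 0 < ‖f x0 - f xh‖ := by
        rw [norm_pos_iff, sub_ne_zero]
        exact fun h => hx (hD.1 hx0 hxh h)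
      have hmem' : ((yh, x0) : Euc n × Euc n) ∈ V ×ˢ A := ⟨hyh, hx0⟩
      have k1 : ContinuousWithinAt (fun z : Euc n × Euc n => H (z.2, z.1)) (V ×ˢ A) (yh, x0) :=
        (hHc.comp (f := fun z : Euc n × Euc n => (z.2, z.1)) (by fun_prop)
          (fun z hz => ⟨hz.2, hz.1⟩)) _ hmem'
      have k2 : ContinuousWithinAt (fun z : Euc n × Euc n => H (xh, z.1)) (V ×ˢ A) (yh, x0) :=
        (hHc.comp (f := fun z : Euc n × Euc n => (xh, z.1)) (by fun_prop)
          (fun z hz => ⟨hxh, hz.1⟩)) _ hmem'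
      have k3 : ContinuousWithinAt (fun z : Euc n × Euc n => H (z.2, yh)) (V ×ˢ A) (yh, x0) :=
        (hHc.comp (f := fun z : Euc n × Euc n => (z.2, yh)) (by fun_prop)
          (fun z hz => ⟨hz.2, hyh⟩)) _ hmem'
      have k4 : ContinuousWithinAt (fun z : Euc n × Euc n => N z.1) (V ×ˢ A) (yh, x0) :=
        (hNc.comp_of_eq continuousAt_fst rfl).continuousWithinAt
      have k5 : ContinuousWithinAt (fun z : Euc n × Euc n => f z.2) (V ×ˢ A) (yh, x0) :=
        (hfc.comp (f := fun z : Euc n × Euc n => z.2) (by fun_prop)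
          (fun z hz => hz.2)) _ hmem'
      have k6 : ContinuousWithinAt (fun z : Euc n × Euc n => ω * ‖f z.2 - f xh‖ ^ 2 -
          ‖H (z.2, z.1) - H (xh, z.1) - N z.1 (H (z.2, yh) - H (xh, yh))‖)
          (V ×ˢ A) (yh, x0) :=
        (continuousWithinAt_const.mul ((k5.sub continuousWithinAt_const).norm.pow 2)).sub
          ((k1.sub k2).sub (k4.clm_apply (k3.sub continuousWithinAt_const))).norm
      have k7 := k6.eventually (lt_mem_nhds (a := 0) (by
        simp only [hN1, ContinuousLinearMap.id_apply, sub_self, norm_zero, sub_zero]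
        positivity))
      have k8 := eventually_nhdsWithin_iff.1 k7
      have k9 : ∀ᶠ z : Euc n × Euc n in 𝓝 (yh, x0), z.1 ∈ V :=
        continuousAt_fst.eventually (hV.mem_nhds hyh)
      filter_upwards [k8, k9] with z hz hz1 hzA
      exact (sub_pos.1 (hz ⟨hz1, hzA⟩)).le
  have hglob := hAc.eventually_forall_of_forall_eventually
    (P := fun y x => x ∈ A → ‖H (x, y) - H (xh, y) - N y (H (x, yh) - H (xh, yh))‖
        ≤ ω * ‖f x - f xh‖ ^ 2) hloc
  obtain ⟨ρ, hρ, hρs⟩ := Metric.eventually_nhds_iff_ball.1 (hglob.and (ball_mem_nhds yh hr0))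
  refine ⟨ρ, hρ, fun y hy => hr0V (hρs y hy).2, fun y hy x hx => ?_⟩
  set e : Euc n → ℝ := fun y =>
    (-(c x y - c xh y) + (c x yh - c xh yh)) - inner ℝ (f x - f xh) (p y) with he
  have hed : ∀ y ∈ ball yh ρ, HasFDerivAt e
      (-(H (x, y) - H (xh, y)) - (innerSL ℝ (f x - f xh)).comp (p' y)) y := by
    intro y hy
    have hyV := hr0V (hρs y hy).2
    have h1 := ((hHd (x, y) ⟨hx, hyV⟩).sub (hHd (xh, y) ⟨hxh, hyV⟩)).neg.add_const
      (c x yh - c xh yh)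
    have h2 := (innerSL ℝ (f x - f xh)).hasFDerivAt.comp y (hpd y (hρs y hy).2)
    exact h1.sub h2
  have hfx : f x - f xh = -J (H (x, yh) - H (xh, yh)) := by
    rw [hfH, hfH, map_sub]; abel
  have hbound : ∀ y ∈ ball yh ρ,
      ‖-(H (x, y) - H (xh, y)) - (innerSL ℝ (f x - f xh)).comp (p' y)‖
        ≤ ω * ‖f x - f xh‖ ^ 2 := by
    intro y hy
    refine le_trans (le_of_eq ?_) ((hρs y hy).1 x hx hx)
    rw [← norm_neg]
    congr 1
    ext η
    have h3 := hp'inner y (hρs y hy).2 (f x - f xh) η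
    simp only [ContinuousLinearMap.neg_apply, ContinuousLinearMap.sub_apply,
      ContinuousLinearMap.comp_apply, innerSL_apply_apply, hN]
    rw [h3, hfx]
    simp
    ring
  have hfin := Convex.norm_image_sub_le_of_norm_hasFDerivWithin_le (s := ball yh ρ) (f := e)
    (fun y hy => (hed y hy).hasFDerivWithinAt) hbound (convex_ball _ _) (mem_ball_self hρ) hy
  have he0 : e yh = 0 := by simp [he, hp]
  rw [he0, sub_zero] at hfin
  exact hfin

/-- Contraction by a factor `θ` along the unit vector `ν`. -/
noncomputable def bnmS {n : ℕ} (ν : Euc n) (θ : ℝ) : Euc n →ₗ[ℝ] Euc n :=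
  LinearMap.transvection ((θ - 1) • (innerSL ℝ ν : Euc n →L[ℝ] ℝ).toLinearMap) ν

theorem bnmS_apply {n : ℕ} (ν : Euc n) (θ : ℝ) (v : Euc n) :
    bnmS ν θ v = v + ((θ - 1) * inner ℝ ν v) • ν := by
  simp [bnmS, LinearMap.transvection.apply]

theorem bnmS_det {n : ℕ} {ν : Euc n} (hν : ‖ν‖ = 1) (θ : ℝ) : LinearMap.det (bnmS ν θ) = θ := by
  rw [bnmS, LinearMap.transvection.det]
  simp [hν]

theorem bnm_P {n : ℕ} {ν w : Euc n} {θ t : ℝ} (hν : ‖ν‖ = 1) (hθ : 0 < θ) (hθ1 : θ ≤ 1)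
    (ht : 0 < t) (hw : ‖bnmS ν θ (w - t • ν)‖ ≤ t * θ / 2) :
    ‖w‖ ≤ 2 * t ∧ ∀ q : Euc n, inner ℝ q ν ≤ 0 →
      inner ℝ q w ≤ (t / 2) * inner ℝ q ν + t * θ * ‖q‖ / 2 := by
  set g := w - t • ν with hg
  set s := bnmS ν θ g with hs
  set a : ℝ := inner ℝ ν g with ha
  have hνν : inner ℝ ν ν = (1 : ℝ) := by simp [hν]
  have hs1 : s = g + ((θ - 1) * a) • ν := bnmS_apply ν θ g
  have hs2 : inner ℝ ν s = θ * a := by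
    rw [hs1, inner_add_right, inner_smul_right, hνν]; ring
  have h3 : |θ * a| ≤ t * θ / 2 := by
    rw [← hs2]
    refine (abs_real_inner_le_norm ν s).trans ?_
    rw [hν, one_mul]; exact hw
  have h4 : |a| ≤ t / 2 := by
    rw [abs_mul, abs_of_pos hθ] at h3
    nlinarith
  have hwe : w = (t + (1 - θ) * a) • ν + s := by
    have : w = g + t • ν := by rw [hg]; abel
    rw [this, hs1]
    module
  obtain ⟨h5, h6⟩ := abs_le.1 h4
  constructor
  · rw [hwe]
    refine (norm_add_le _ _).trans ?_
    rw [norm_smul, hν, Real.norm_eq_abs, mul_one]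
    have : |t + (1 - θ) * a| ≤ t + t / 2 := by
      rw [abs_le]; constructor <;> nlinarith
    have : t * θ / 2 ≤ t / 2 := by nlinarith
    linarith
  · intro q hq
    rw [hwe, inner_add_right, inner_smul_right]
    have h7 : inner ℝ q s ≤ t * θ * ‖q‖ / 2 := by
      refine (real_inner_le_norm q s).trans ?_
      have := mul_le_mul_of_nonneg_left hw (norm_nonneg q)
      linarith
    have h8 : t / 2 ≤ t + (1 - θ) * a := by nlinarith
    have := mul_le_mul_of_nonpos_right h8 hq
    linarith

theorem bnm_Z {n : ℕ} {ν q : Euc n} {θ R : ℝ} (hν : ‖ν‖ = 1) (hθ : 0 < θ) (hθ1 : θ ≤ 1)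
    (hR : 0 < R) (hq : ‖q‖ ≤ 4 * R * θ) (hq2 : |inner ℝ q ν| ≤ 8 * R * θ ^ 2) :
    q ∈ bnmS ν θ '' closedBall 0 (12 * R * θ) := by
  have hνν : inner ℝ ν ν = (1 : ℝ) := by simp [hν]
  set b : ℝ := inner ℝ q ν with hb
  have hb' : inner ℝ ν q = b := real_inner_comm _ _
  refine ⟨q + ((1 / θ - 1) * b) • ν, ?_, ?_⟩
  · rw [mem_closedBall_zero_iff]
    refine (norm_add_le _ _).trans ?_
    rw [norm_smul, hν, Real.norm_eq_abs, mul_one, abs_mul]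
    have h1 : |1 / θ - 1| ≤ 1 / θ := by
      have : 1 ≤ 1 / θ := by rw [le_div_iff₀ hθ]; linarith
      rw [abs_le]; constructor <;> linarith
    have h2 := mul_le_mul h1 hq2 (abs_nonneg _) (by positivity)
    have h3 : 1 / θ * (8 * R * θ ^ 2) = 8 * R * θ := by field_simp
    linarith
  · rw [bnmS_apply, inner_add_right, inner_smul_right, hνν, hb']
    rw [add_assoc, ← add_smul]
    have : (1 / θ - 1) * b + (θ - 1) * (b + (1 / θ - 1) * b * 1) = 0 := by
      field_simp; ring
    rw [this, zero_smul, add_zero]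

theorem bnm_Z2 {n : ℕ} {ν q : Euc n} {θ r : ℝ} (hν : ‖ν‖ = 1) (hθ : 0 < θ) (hθ1 : θ ≤ 1)
    (hq : q ∈ bnmS ν θ '' closedBall 0 r) : ‖q‖ ≤ 2 * r := by
  obtain ⟨w, hw, rfl⟩ := hq
  rw [mem_closedBall_zero_iff] at hw
  rw [bnmS_apply]
  refine (norm_add_le _ _).trans ?_
  rw [norm_smul, hν, Real.norm_eq_abs, mul_one, abs_mul]
  have h1 : |θ - 1| ≤ 1 := by rw [abs_le]; constructor <;> linarith
  have h2 := abs_real_inner_le_norm ν w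
  rw [hν, one_mul] at h2
  have := mul_le_mul h1 h2 (abs_nonneg _) zero_le_one
  linarith

theorem bnm_alg {R t θ b m : ℝ} (hR : 0 < R) (ht : 0 < t) (hθ : 0 < θ) (hm : 0 ≤ m)
    (h1 : m ^ 2 ≤ -(2 * R * b))
    (h2 : 0 ≤ (t / 2) * b + t * θ * m / 2 + (1 / (32 * R)) * m ^ 2 * (4 * t)) :
    m ≤ 4 * R * θ ∧ |b| ≤ 8 * R * θ ^ 2 := by
  have h3 : (1 / (32 * R)) * m ^ 2 ≤ (1 / (32 * R)) * (-(2 * R * b)) := by gcongr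
  have h4 : (1 / (32 * R)) * (-(2 * R * b)) = - b / 16 := by field_simp; ring
  have h5 : 0 ≤ t * (b / 2 + θ * m / 2 - b / 4) := by nlinarith
  have h6 : 0 ≤ b / 2 + θ * m / 2 - b / 4 := nonneg_of_mul_nonneg_right h5 ht
  have h7 : -b ≤ 2 * θ * m := by linarith
  have h8 : m ^ 2 ≤ 4 * R * θ * m := by nlinarith
  have h9 : m ≤ 4 * R * θ := by
    rcases hm.eq_or_lt with h | h
    · rw [← h]; positivity
    · nlinarith
  refine ⟨h9, ?_⟩
  have hb0 : b ≤ 0 := by nlinarith [sq_nonneg m]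
  rw [abs_of_nonpos hb0]
  nlinarith

theorem bnm_volP {n : ℕ} {ν : Euc n} {θ t : ℝ} (hν : ‖ν‖ = 1) (hθ : 0 < θ) (ht : 0 < t) :
    volume {w : Euc n | ‖bnmS ν θ (w - t • ν)‖ ≤ t * θ / 2} =
      ENNReal.ofReal (θ⁻¹ * (t * θ / 2) ^ n) * volume (closedBall (0 : Euc n) 1) := by
  have e : {w : Euc n | ‖bnmS ν θ (w - t • ν)‖ ≤ t * θ / 2} =
      (fun w => w + (-(t • ν))) ⁻¹' (bnmS ν θ ⁻¹' closedBall 0 (t * θ / 2)) := by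
    ext w; simp [sub_eq_add_neg]
  rw [e, measure_preimage_add_right, Measure.addHaar_preimage_linearMap _ (by
    rw [bnmS_det hν]; exact hθ.ne'), bnmS_det hν, Measure.addHaar_closedBall' _ _ (by positivity),
    ← mul_assoc, ← ENNReal.ofReal_mul (by positivity), abs_of_pos (by positivity)]
  simp

theorem bnm_volZ {n : ℕ} {ν : Euc n} {θ r : ℝ} (hν : ‖ν‖ = 1) (hθ : 0 < θ) (hr : 0 < r)
    (a : Euc n) :
    volume ((fun x => a + x) '' (bnmS ν θ '' closedBall 0 r)) =
      ENNReal.ofReal (θ * r ^ n) * volume (closedBall (0 : Euc n) 1) := by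
  rw [image_add_left, measure_preimage_add, Measure.addHaar_image_linearMap,
    bnmS_det hν, Measure.addHaar_closedBall' _ _ hr.le,
    ← mul_assoc, ← ENNReal.ofReal_mul (by positivity), abs_of_pos (by positivity)]
  simp

theorem bnm_final {n : ℕ} {t R : ℝ} {K K2 : ℝ≥0} {Lam θ0 : ℝ} (ht : 0 < t) (hR : 0 < R)
    (hL : 0 < Lam) (hθ0 : 0 < θ0)
    (h : ∀ θ, 0 < θ → θ ≤ θ0 → ENNReal.ofReal (θ⁻¹ * (t * θ / 2) ^ n) *
      volume (closedBall (0 : Euc n) 1) ≤ (K : ℝ≥0∞) ^ n * (ENNReal.ofReal Lam *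
        ((K2 : ℝ≥0∞) ^ n * (ENNReal.ofReal (θ * (12 * R * θ) ^ n) *
          volume (closedBall (0 : Euc n) 1))))) : False := by
  have hv0 : volume (closedBall (0 : Euc n) 1) ≠ 0 :=
    (measure_closedBall_pos _ _ one_pos).ne'
  have hv1 : volume (closedBall (0 : Euc n) 1) ≠ ∞ := measure_closedBall_lt_top.ne
  have h2 : ∀ θ, 0 < θ → θ ≤ θ0 → (t / 2) ^ n ≤
      ((K : ℝ) ^ n * Lam * (K2 : ℝ) ^ n * (12 * R) ^ n) * θ ^ 2 := by
    intro θ hθ hθ1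
    have h3 := h θ hθ hθ1
    have e : (K : ℝ≥0∞) ^ n * (ENNReal.ofReal Lam *
        ((K2 : ℝ≥0∞) ^ n * (ENNReal.ofReal (θ * (12 * R * θ) ^ n) *
          volume (closedBall (0 : Euc n) 1)))) =
        ENNReal.ofReal ((K : ℝ) ^ n * Lam * (K2 : ℝ) ^ n * (θ * (12 * R * θ) ^ n)) *
          volume (closedBall (0 : Euc n) 1) := by
      generalize θ * (12 * R * θ) ^ n = X
      rw [ENNReal.ofReal_mul (by positivity), ENNReal.ofReal_mul (by positivity),
        ENNReal.ofReal_mul (by positivity), ENNReal.ofReal_pow (by positivity),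
        ENNReal.ofReal_pow (by positivity), ENNReal.ofReal_coe_nnreal, ENNReal.ofReal_coe_nnreal]
      ring
    rw [e, ENNReal.mul_le_mul_iff_left hv0 hv1, ENNReal.ofReal_le_ofReal_iff (by positivity)] at h3
    have e2 : θ⁻¹ * (t * θ / 2) ^ n = (θ⁻¹ * θ ^ n) * (t / 2) ^ n := by
      rw [show t * θ / 2 = θ * (t / 2) by ring, mul_pow]; ring
    have e3 : (K : ℝ) ^ n * Lam * (K2 : ℝ) ^ n * (θ * (12 * R * θ) ^ n) = (θ⁻¹ * θ ^ n) *
        (((K : ℝ) ^ n * Lam * (K2 : ℝ) ^ n * (12 * R) ^ n) * θ ^ 2) := by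
      rw [mul_pow (12 * R) θ]; field_simp
    rw [e2, e3] at h3
    exact le_of_mul_le_mul_left h3 (by positivity)
  set C := ((K : ℝ) ^ n * Lam * (K2 : ℝ) ^ n * (12 * R) ^ n) with hC
  have hlim : Tendsto (fun θ : ℝ => C * θ ^ 2) (𝓝[>] 0) (𝓝 0) := by
    have : Tendsto (fun θ : ℝ => C * θ ^ 2) (𝓝 0) (𝓝 (C * 0 ^ 2)) :=
      Continuous.tendsto (by fun_prop) 0
    simp only [ne_eq, OfNat.ofNat_ne_zero, not_false_eq_true, zero_pow, mul_zero] at this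
    exact this.mono_left nhdsWithin_le_nhds
  have hle : (t / 2) ^ n ≤ 0 := by
    refine ge_of_tendsto hlim ?_
    filter_upwards [Ioc_mem_nhdsGT hθ0] with θ hθ
    exact h2 θ hθ.1 hθ.2
  have : 0 < (t / 2) ^ n := by positivity
  linarith

theorem bnm_mono {n : ℕ} {c : Euc n → Euc n → ℝ} {A B : Set (Euc n)} {u : Euc n → ℝ}
    (h : ∀ x ∈ A, ∀ y ∈ B, -c x y - u x ≤ cStarT n c A u y) {x xh y yh : Euc n}
    (h1 : (x, y) ∈ cSubdiff n c A B u) (h2 : (xh, yh) ∈ cSubdiff n c A B u) :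
    0 ≤ -(c x y - c xh y) + (c x yh - c xh yh) := by
  obtain ⟨hx, hy, e1⟩ := h1
  obtain ⟨hxh, hyh, e2⟩ := h2
  simp only at hx hy e1 hxh hyh e2
  have h3 := h xh hxh y hy
  have h4 := h x hx yh hyh
  linarith

theorem bnm_image_closure {n : ℕ} {f : Euc n → Euc n} {U : Set (Euc n)} (hUb : IsBounded U)
    (hf : ContinuousOn f (closure U)) : f '' closure U = closure (f '' U) := by
  apply Subset.antisymm
  · exact hf.image_closure
  · exact closure_minimal (image_mono subset_closure)
      (hUb.isCompact_closure.image_of_continuousOn hf).isClosed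

theorem bnm_p {n : ℕ} {p : Euc n → Euc n} {yh : Euc n}
    (hp : HasStrictFDerivAt p (ContinuousLinearMap.id ℝ (Euc n)) yh) (hp0 : p yh = 0)
    {ρ0 : ℝ} (hρ0 : 0 < ρ0) :
    ∃ ρ > 0, ρ ≤ ρ0 ∧ (∀ y ∈ ball yh ρ, ‖y - yh‖ ≤ 2 * ‖p y‖) ∧
      ∃ t > 0, ∃ K : ℝ≥0, LipschitzOnWith K p (ball yh ρ) ∧
        closedBall 0 (2 * t) ⊆ p '' ball yh ρ := by
  obtain ⟨K, s, hs, hK⟩ := hp.exists_lipschitzOnWith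
  have h1 := hp.hasFDerivAt.isLittleO.def (c := 1 / 2) (by norm_num)
  obtain ⟨r1, hr1, h1⟩ := Metric.eventually_nhds_iff_ball.1 h1
  obtain ⟨r2, hr2, h2⟩ := Metric.mem_nhds_iff.1 hs
  set ρ := min ρ0 (min r1 r2) with hρ
  have hρp : 0 < ρ := by positivity
  refine ⟨ρ, hρp, min_le_left _ _, ?_, ?_⟩
  · intro y hy
    have h3 := h1 y (ball_subset_ball ((min_le_right _ _).trans (min_le_left _ _)) hy)
    rw [hp0, sub_zero] at h3
    have h4 : ‖y - yh‖ ≤ ‖p y‖ + ‖p y - (y - yh)‖ := by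
      have := norm_sub_le (p y) (p y - (y - yh))
      rwa [sub_sub_cancel] at this
    simp only [ContinuousLinearMap.coe_id', id_eq] at h3
    linarith
  · have hmap := HasStrictFDerivAt.map_nhds_eq_of_equiv (f := p) (a := yh)
      (f' := ContinuousLinearEquiv.refl ℝ (Euc n)) hp
    have h5 : p '' ball yh ρ ∈ 𝓝 (0 : Euc n) := by
      rw [← hp0, ← hmap]
      exact image_mem_map (ball_mem_nhds _ hρp)
    obtain ⟨r, hr, h6⟩ := Metric.nhds_basis_closedBall.mem_iff.1 h5
    refine ⟨r / 2, by positivity, K, hK.mono ((ball_subset_ball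
      ((min_le_right _ _).trans (min_le_right _ _))).trans h2), ?_⟩
    rwa [mul_div_cancel₀ _ (two_ne_zero)]

theorem bnm_main (n : ℕ) (c : Euc n → Euc n → ℝ)
    (U V : Set (Euc n)) (u : Euc n → ℝ) (Lam : ℝ)
    (hB0 : B0cond n c U V) (hB1 : B1cond n c U V)
    (hu : CConvexOn n c (closure U) (closure V) u)
    (hLam : 0 < Lam)
    (hle : MAle n c (closure U) (closure V) u Lam (closure U))
    (hUs : ∀ y ∈ closure V, StronglyConvexSet n (Uyset n c U y)) :
    Disjoint (frontier U ×ˢ V) (cSubdiff n c (closure U) (closure V) u) := by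
  obtain ⟨hU, hUb, hV, hVb, hc⟩ := hB0
  rw [Set.disjoint_left]
  rintro ⟨xh, yh⟩ ⟨hxf, hyh⟩ hsub
  simp only at hxf hyh
  have hxh : xh ∈ closure U := hxf.1
  have hxU : xh ∉ U := by
    rw [hU.frontier_eq] at hxf; exact hxf.2
  have hAc := hUb.isCompact_closure
  have hBc := hVb.isCompact_closure
  obtain ⟨hsup, hex⟩ := bnm_cconv hAc hBc ⟨xh, hxh⟩ ⟨yh, subset_closure hyh⟩ hc.continuousOn hu
  have hD := hB1.1 yh (subset_closure hyh)
  obtain ⟨hQc, R, hR, hball⟩ := hUs yh (subset_closure hyh)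
  set f : Euc n → Euc n := fun x => -gradY n c x yh with hf
  have hfU : Uyset n c U yh = f '' U := rfl
  rw [hfU] at hQc hball
  have hfc : ContinuousOn f (closure U) := hD.2.1.continuousOn
  have hcl := bnm_image_closure hUb hfc
  have hconv : Convex ℝ (f '' closure U) := by rw [hcl]; exact hQc.closure
  have hfr : f xh ∈ frontier (f '' U) := by
    refine ⟨hcl ▸ mem_image_of_mem f hxh, fun hi => ?_⟩
    obtain ⟨x, hx, hxe⟩ := interior_subset hi
    exact hxU (hD.1 (subset_closure hx) hxh hxe ▸ hx)
  obtain ⟨z, hz, hzb⟩ := hball _ hfr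
  have hQb : f '' closure U ⊆ closedBall z R := by
    rw [hcl]; exact closure_minimal hzb isClosed_closedBall
  set ν : Euc n := R⁻¹ • (f xh - z) with hν
  have hzn : ‖f xh - z‖ = R := by rw [← dist_eq_norm]; exact hz
  have hν1 : ‖ν‖ = 1 := by
    rw [hν, norm_smul, hzn, Real.norm_eq_abs, abs_of_pos (by positivity)]
    field_simp
  have hRν : R • ν = f xh - z := by rw [hν, smul_smul, mul_inv_cancel₀ hR.ne', one_smul]
  have hq : ∀ x ∈ closure U, ‖f x - f xh‖ ^ 2 ≤ -(2 * R * inner ℝ (f x - f xh) ν) := by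
    intro x hx
    have h1 := hQb (mem_image_of_mem f hx)
    rw [mem_closedBall, dist_eq_norm] at h1
    have h2 : f x - z = (f x - f xh) + R • ν := by rw [hRν]; abel
    rw [h2] at h1
    have h3 := norm_add_sq_real (f x - f xh) (R • ν)
    rw [norm_smul, hν1, Real.norm_eq_abs, abs_of_pos hR, inner_smul_right, mul_one] at h3
    have h4 := pow_le_pow_left₀ (norm_nonneg _) h1 2
    linarith
  obtain ⟨p, hp, hp0, hexp⟩ := bnm_expand hU hUb hV hxh hyh hc hf hD hconv
  obtain ⟨ρ0, hρ0, hρV, hexp⟩ := hexp (1 / (32 * R)) (by positivity)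
  obtain ⟨ρ, hρ, hρρ, hpy, t, ht, K, hK, hpim⟩ := bnm_p hp hp0 hρ0
  set X := Function.invFunOn f (closure U) with hX
  obtain ⟨K2, s, hs, hK2⟩ :=
    (hD.2.2 (f xh) (mem_image_of_mem f hxh)).exists_lipschitzOnWith hconv
  obtain ⟨r, hr, hrs⟩ := Metric.mem_nhdsWithin_iff.1 hs
  have hXf : ∀ x ∈ closure U, X (f x) = x := fun x hx => hD.1.leftInvOn_invFunOn hx
  set θ0 : ℝ := min 1 (r / (48 * R)) with hθ0
  have hθ0p : 0 < θ0 := by positivity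
  refine bnm_final (n := n) (K := K) (K2 := K2) ht hR hLam hθ0p fun θ hθ hθle => ?_
  have hθ1 : θ ≤ 1 := hθle.trans (min_le_left _ _)
  have hθr : 24 * R * θ < r := by
    have h1 := hθle.trans (min_le_right _ _)
    rw [le_div_iff₀ (by positivity)] at h1
    linarith
  set P : Set (Euc n) := {w : Euc n | ‖bnmS ν θ (w - t • ν)‖ ≤ t * θ / 2} with hP
  set Y := ball yh ρ ∩ p ⁻¹' P with hY
  set Z : Set (Euc n) := bnmS ν θ '' closedBall 0 (12 * R * θ) with hZ
  set W : Set (Euc n) := (fun x => f xh + x) '' Z with hW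
  set XX := closure U ∩ f ⁻¹' W with hXX
  have hZc : IsCompact Z :=
    (isCompact_closedBall _ _).image (bnmS ν θ).continuous_of_finiteDimensional
  have hWc : IsCompact W := hZc.image (by fun_prop)
  have hXXm : MeasurableSet XX :=
    (hfc.preimage_isClosed_of_isClosed isClosed_closure hWc.isClosed).measurableSet
  have hYX : Y ⊆ cSubdiffImg n c (closure U) (closure V) u XX := by
    intro y hy
    have hyV : y ∈ closure V := subset_closure (hρV (ball_subset_ball hρρ hy.1))
    obtain ⟨x, hx, hxy⟩ := hex y hyV
    have hF := bnm_mono hsup hxy hsub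
    have hE := (abs_le.1 (hexp y (ball_subset_ball hρρ hy.1) x hx)).2
    obtain ⟨hPn, hPi⟩ := bnm_P hν1 hθ hθ1 ht hy.2
    have hqx := hq x hx
    have hin : inner ℝ (f x - f xh) ν ≤ 0 := by
      by_contra! hcon
      have : 0 < 2 * R * inner ℝ (f x - f xh) ν := by positivity
      linarith [sq_nonneg ‖f x - f xh‖]
    have h1 := hPi _ hin
    have h2 : ‖y - yh‖ ≤ 4 * t := by linarith [hpy y hy.1]
    have h3 : (1 / (32 * R)) * ‖f x - f xh‖ ^ 2 * ‖y - yh‖ ≤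
        (1 / (32 * R)) * ‖f x - f xh‖ ^ 2 * (4 * t) := by gcongr
    obtain ⟨h4, h5⟩ := bnm_alg hR ht hθ (norm_nonneg (f x - f xh)) hqx (by linarith)
    have h6 := bnm_Z hν1 hθ hθ1 hR h4 h5
    refine mem_iUnion₂.2 ⟨x, ⟨hx, ⟨f x - f xh, h6, by simp⟩⟩, hxy⟩
  have hPY : P ⊆ p '' Y := by
    intro w hw
    have h1 : w ∈ closedBall (0 : Euc n) (2 * t) := by
      rw [mem_closedBall_zero_iff]; exact (bnm_P hν1 hθ hθ1 ht hw).1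
    obtain ⟨y, hy, rfl⟩ := hpim h1
    exact ⟨y, ⟨hy, hw⟩, rfl⟩
  have hXW : XX ⊆ X '' (f '' closure U ∩ W) := fun x hx =>
    ⟨f x, ⟨mem_image_of_mem f hx.1, hx.2⟩, hXf x hx.1⟩
  have hWs : f '' closure U ∩ W ⊆ s := by
    rintro _ ⟨h1, ⟨q, hqZ, rfl⟩⟩
    refine hrs ⟨?_, h1⟩
    rw [mem_ball, dist_eq_norm, add_sub_cancel_left]
    have := bnm_Z2 hν1 hθ hθ1 hqZ
    linarith
  rw [← bnm_volP hν1 hθ ht, ← bnm_volZ hν1 hθ (by positivity : 0 < 12 * R * θ) (f xh)]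
  calc volume P ≤ volume (p '' Y) := measure_mono hPY
    _ ≤ (K : ℝ≥0∞) ^ n * volume Y := bnm_lip_vol (hK.mono inter_subset_left)
    _ ≤ (K : ℝ≥0∞) ^ n * (ENNReal.ofReal Lam * volume XX) := by
        gcongr
        exact (measure_mono hYX).trans (hle XX inter_subset_left hXXm)
    _ ≤ _ := by
        gcongr
        refine (measure_mono hXW).trans ((bnm_lip_vol (hK2.mono hWs)).trans ?_)
        gcongr
        exact inter_subset_right

end BNM

/-- Theorem 5.1(b): boundary points are not mapped to interior points. -/
theorem boundary_not_mapped_to_interior (n : ℕ) (c : Euc n → Euc n → ℝ)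
    (U V : Set (Euc n)) (u : Euc n → ℝ) (Lam : ℝ)
    (hB0 : B0cond n c U V) (hB1 : B1cond n c U V)
    (hu : CConvexOn n c (closure U) (closure V) u)
    (hLam : 0 < Lam)
    (hle : MAle n c (closure U) (closure V) u Lam (closure U))
    (hUs : ∀ y ∈ closure V, StronglyConvexSet n (Uyset n c U y)) :
    Disjoint (frontier U ×ˢ V) (cSubdiff n c (closure U) (closure V) u) := by
  exact bnm_main n c U V u Lam hB0 hB1 hu hLam hle hUs
end
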